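/- arXiv:2203.13804 — 3 statements merged into one kernel-verified Lean document; each statement's English description precedes it below -/
import Mathlib

section
/- For every even sufficiently large Q (depending on ℓ ∈ ℕ) and every k ∈ ℕ, there exists a non-negative finite Borel measure σ on the torus T, supported on the Q^{k+1}-th roots of unity, such that: σ̂(0) ≤ 1 + 320·ℓ³/Q², σ̂(m) = 1 for all m ∈ ℤ with 1 ≤ m/Q^k ≤ ℓ, and σ̂(m) = -1 for all m ∈ ℤ with Q/2 ≤ m/Q^k ≤ Q/2 + ℓ. -/
open MeasureTheory

/-- The Fourier transform `σ̂(k) = ∫_T e^{-2πikt} dσ(t)` of a measure on the torus. -/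
noncomputable def measureFourier (μ : MeasureTheory.Measure UnitAddCircle) (k : ℤ) : ℂ :=
  ∫ t : UnitAddCircle, fourier (-k) t ∂μ

open Finset in
/-- Summing a `Q`-periodic function over the residue class of `a` in one period gives `f a`. -/
lemma sum_range_ite_dvd_sub {Q : ℕ} (hQ : 0 < Q) {f : ℤ → ℂ} (hf : Function.Periodic f (Q : ℤ))
    (a : ℤ) : ∑ n ∈ range Q, (if (Q : ℤ) ∣ (n : ℤ) - a then f n else 0) = f a := by
  have hQ' : (0 : ℤ) < Q := by exact_mod_cast hQ
  have h0 := Int.emod_nonneg a hQ'.ne'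
  have h1 := Int.emod_lt_of_pos a hQ'
  have hcast : ((a % Q).toNat : ℤ) = a % Q := Int.toNat_of_nonneg h0
  rw [sum_eq_single_of_mem (a % Q).toNat]
  · rw [hcast, if_pos (Int.dvd_of_emod_eq_zero (by simp [Int.sub_emod]))]
    conv_rhs => rw [← Int.emod_add_mul_ediv a Q, mul_comm (Q : ℤ)]
    exact (hf.int_mul (a / Q) (a % Q)).symm
  · rw [mem_range]; omega
  · intro n hn hne
    rw [if_neg]
    intro hd
    apply hne
    have : (n : ℤ) % Q = a % Q :=
      Int.emod_eq_emod_iff_emod_sub_eq_zero.mpr (Int.emod_eq_zero_of_dvd hd)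
    rw [Int.emod_eq_of_lt (by positivity) (by exact_mod_cast mem_range.mp hn)] at this
    omega

open Finset in
lemma IsPrimitiveRoot.sum_range_zpow {N : ℕ} {ζ : ℂ} (hζ : IsPrimitiveRoot ζ N) (x : ℤ) :
    ∑ j ∈ range N, ζ ^ (x * j) = if (N : ℤ) ∣ x then (N : ℂ) else 0 := by
  simp_rw [zpow_mul, zpow_natCast]
  split_ifs with h
  · simp [(hζ.zpow_eq_one_iff_dvd x).mpr h]
  · have h1 : ζ ^ x ≠ 1 := fun h' ↦ h ((hζ.zpow_eq_one_iff_dvd x).mp h')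
    rw [geom_sum_eq h1, ← zpow_natCast, ← zpow_mul, mul_comm, zpow_mul, zpow_natCast,
      hζ.pow_eq_one, one_zpow, sub_self, zero_div]

open Finset in
/-- A `Q`-periodic function on `ℤ` with nonnegative discrete Fourier transform `D` is interpolated
linearly, from multiples of `M` to all integers, by the transform of nonnegative weights on
`ℤ / QMℤ`. -/
lemma exists_weights_interpolating {Q M : ℕ} (hQ : 0 < Q) (hM : 0 < M) {ζ : ℂ}
    (hζ : IsPrimitiveRoot ζ (Q * M)) (hconj : starRingEnd ℂ ζ = ζ⁻¹)
    {A : ℤ → ℂ} (hA : Function.Periodic A (Q : ℤ)) {D : ℕ → ℝ} (hD : ∀ j, 0 ≤ D j)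
    (hAD : ∀ j : ℕ, (D j : ℂ) = ∑ n ∈ range Q, A n * ζ ^ ((M : ℤ) * n * j)) :
    ∃ w : ℕ → ℝ, (∀ j, 0 ≤ w j) ∧ ∀ (m : ℤ) (v : ℂ),
      (∀ n : ℤ, |m - M * n| < M → A n = v) →
        ∑ j ∈ range (Q * M), (w j : ℂ) * ζ ^ (-m * j) = v := by
  have hMz : (0 : ℤ) < M := by exact_mod_cast hM
  have hQc : (Q : ℂ) ≠ 0 := by exact_mod_cast hQ.ne'
  have hMc : (M : ℂ) ≠ 0 := by exact_mod_cast hM.ne'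
  have hζ0 : ζ ≠ 0 := hζ.ne_zero (by positivity)
  refine ⟨fun j ↦ D j / (Q * M * M) * Complex.normSq (∑ r ∈ range M, ζ ^ ((r : ℤ) * j)),
    fun j ↦ mul_nonneg (div_nonneg (hD j) (by positivity)) (Complex.normSq_nonneg _), ?_⟩
  intro m v hv
  have hterm : ∀ j : ℕ, ((D j / (Q * M * M) *
      Complex.normSq (∑ r ∈ range M, ζ ^ ((r : ℤ) * j)) : ℝ) : ℂ) * ζ ^ (-m * j) =
      (Q * M * M : ℂ)⁻¹ * ∑ r ∈ range M, ∑ s ∈ range M, ∑ n ∈ range Q,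
        A n * ζ ^ (((M : ℤ) * n - (m - r + s)) * j) := by
    intro j
    have hs : starRingEnd ℂ (∑ r ∈ range M, ζ ^ ((r : ℤ) * j)) =
        ∑ s ∈ range M, ζ ^ (-(s : ℤ) * j) := by
      rw [map_sum]
      refine sum_congr rfl fun s _ ↦ ?_
      rw [map_zpow₀, hconj, inv_zpow', neg_mul]
    push_cast
    rw [← Complex.mul_conj, hs, hAD, div_eq_inv_mul, mul_assoc, mul_assoc]
    congr 1
    rw [sum_mul_sum, mul_comm, sum_mul, sum_mul]
    refine sum_congr rfl fun r _ ↦ ?_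
    rw [sum_mul, sum_mul]
    refine sum_congr rfl fun s _ ↦ ?_
    rw [mul_sum]
    refine sum_congr rfl fun n _ ↦ ?_
    have : ((M : ℤ) * n - (m - r + s)) * j = r * j + -s * j + -m * j + M * n * j := by ring
    rw [this, zpow_add₀ hζ0, zpow_add₀ hζ0, zpow_add₀ hζ0]
    ring
  rw [sum_congr rfl fun j _ ↦ hterm j, ← mul_sum, sum_comm]
  have hr : ∀ r ∈ range M, ∑ j ∈ range (Q * M), ∑ s ∈ range M, ∑ n ∈ range Q,
        A n * ζ ^ (((M : ℤ) * n - (m - r + s)) * j) = Q * M * v := by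
    intro r hr
    have hrM : (r : ℤ) < M := by exact_mod_cast mem_range.mp hr
    have hs0 := Int.emod_nonneg (r - m) hMz.ne'
    have hs1 := Int.emod_lt_of_pos (r - m) hMz
    have hsc : (((r - m) % M).toNat : ℤ) = (r - m) % M := Int.toNat_of_nonneg hs0
    have hdiv := Int.emod_add_mul_ediv (r - m) M
    have horth : ∀ s ∈ range M, ∑ j ∈ range (Q * M), ∑ n ∈ range Q,
        A n * ζ ^ (((M : ℤ) * n - (m - r + s)) * j) = ∑ n ∈ range Q,
          A n * (if ((Q * M : ℕ) : ℤ) ∣ (M : ℤ) * n - (m - r + s) then ((Q * M : ℕ) : ℂ) else 0) := by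
      intro s _
      rw [sum_comm]
      refine sum_congr rfl fun n _ ↦ ?_
      rw [← mul_sum, hζ.sum_range_zpow]
    rw [sum_comm, sum_congr rfl horth, sum_eq_single_of_mem ((r - m) % M).toNat]
    · set q := -((r - m) / (M : ℤ)) with hq
      have hy : m - r + (((r - m) % M).toNat : ℤ) = M * q := by
        rw [hsc, hq]; linarith
      have hqv : A q = v := by
        apply hv
        rw [← hy, hsc, abs_lt]
        constructor <;> linarith [Int.natCast_nonneg r]
      rw [hy, ← hqv, ← sum_range_ite_dvd_sub hQ hA q, mul_sum]
      refine sum_congr rfl fun n _ ↦ ?_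
      have : ((Q * M : ℕ) : ℤ) ∣ (M : ℤ) * n - M * q ↔ (Q : ℤ) ∣ n - q := by
        rw [← mul_sub, Nat.cast_mul, mul_comm (Q : ℤ)]
        exact mul_dvd_mul_iff_left hMz.ne'
      simp only [this]
      split_ifs
      · push_cast; ring
      · simp
    · rw [mem_range]; omega
    · intro s hs hne
      refine sum_eq_zero fun n _ ↦ ?_
      rw [if_neg, mul_zero]
      intro hd
      apply hne
      have h1 : (M : ℤ) ∣ (r - m) - s := by
        have h2 : (M : ℤ) ∣ (M : ℤ) * n - (m - r + s) := (by simp : (M : ℤ) ∣ (Q * M : ℕ)).trans hd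
        have h3 := h2.sub (dvd_mul_right (M : ℤ) n)
        rwa [show (M : ℤ) * n - (m - r + s) - M * n = r - m - s by ring] at h3
      have h4 := Int.emod_eq_emod_iff_emod_sub_eq_zero.mpr (Int.emod_eq_zero_of_dvd h1)
      rw [Int.emod_eq_of_lt (b := (M : ℤ)) (a := s) (by positivity)
        (by exact_mod_cast mem_range.mp hs)] at h4
      omega
  rw [sum_congr rfl hr]
  simp only [sum_const, card_range, nsmul_eq_mul]
  field_simp

open Finset in
/-- Nonnegative weights on the `N`-th roots of unity define a finite measure on the circle. -/
lemma exists_measure_of_weights {N : ℕ} {w : ℕ → ℝ} (hw : ∀ j, 0 ≤ w j) :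
    ∃ σ : Measure UnitAddCircle, IsFiniteMeasure σ ∧
      σ ({x : UnitAddCircle | ∃ j : ℕ, j < N ∧ x = ((j : ℝ) / (N : ℝ) : ℝ)}ᶜ) = 0 ∧
      ∀ m : ℤ, measureFourier σ m =
        ∑ j ∈ range N, (w j : ℂ) * Complex.exp (2 * Real.pi * Complex.I / N) ^ (-m * j) := by
  refine ⟨∑ j ∈ range N, ENNReal.ofReal (w j) •
    Measure.dirac (((j : ℝ) / (N : ℝ) : ℝ) : UnitAddCircle), ?_, ?_, ?_⟩
  · refine ⟨?_⟩
    simp [ENNReal.sum_lt_top]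
  · rw [Measure.finsetSum_apply]
    refine sum_eq_zero fun j hj ↦ ?_
    rw [Measure.smul_apply, Measure.dirac_apply]
    simp only [smul_eq_mul, mul_eq_zero]
    right
    rw [Set.indicator_of_notMem]
    simp only [Set.mem_compl_iff, not_not]
    exact ⟨j, mem_range.mp hj, rfl⟩
  · intro m
    unfold measureFourier
    rw [integral_finsetSum_measure]
    · refine sum_congr rfl fun j _ ↦ ?_
      rw [integral_smul_measure, integral_dirac, ENNReal.toReal_ofReal (hw j), fourier_coe_apply,
        Complex.real_smul, ← Complex.exp_int_mul]
      congr 2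
      push_cast
      ring
    · intro j _
      refine Integrable.smul_measure ?_ ENNReal.ofReal_ne_top
      exact integrable_dirac (by simp)

open Finset Real in
/-- The cyclic model: a nonnegative-definite function on `ℤ / 2hℤ` equal to `1` on `[1, ℓ]` and
to `-1` on `[h, h + ℓ]`, with value at most `1 + 320 ℓ³ / (2h)²` at the origin. -/
lemma exists_cyclic_model {ℓ h Q : ℕ} (hQ : Q = 2 * h) (hh : 2 * ℓ < h) :
    ∃ (A : ℤ → ℂ) (D : ℕ → ℝ) (ε : ℝ), Function.Periodic A (Q : ℤ) ∧ (∀ j, 0 ≤ D j) ∧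
      (∀ j : ℕ, (D j : ℂ) =
        ∑ n ∈ range Q, A n * Complex.exp (2 * π * Complex.I / Q) ^ ((n : ℤ) * j)) ∧
      ε ≤ 320 * (ℓ : ℝ) ^ 3 / (Q : ℝ) ^ 2 ∧ A 0 = 1 + ε ∧
      (∀ n : ℤ, 1 ≤ n → n ≤ ℓ → A n = 1) ∧ (∀ n : ℤ, h ≤ n → n ≤ h + ℓ → A n = -1) := by
  have hQ0 : Q ≠ 0 := by omega
  have hω := Complex.isPrimitiveRoot_exp Q hQ0
  set ω := Complex.exp (2 * π * Complex.I / Q) with hωdef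
  have hω0 : ω ≠ 0 := hω.ne_zero hQ0
  have hωper : ∀ j : ℤ, Function.Periodic (fun n : ℤ ↦ ω ^ (n * j)) (Q : ℤ) := by
    intro j n
    simp only
    rw [add_mul, zpow_add₀ hω0, zpow_mul ω (Q : ℤ), zpow_natCast, hω.pow_eq_one, one_zpow, mul_one]
  have hωh : ω ^ (h : ℤ) = -1 := by
    have hhC : (h : ℂ) ≠ 0 := by exact_mod_cast (by omega : h ≠ 0)
    rw [hωdef, ← Complex.exp_int_mul, ← Complex.exp_pi_mul_I]
    congr 1
    rw [hQ]
    push_cast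
    field_simp
  let c : ℤ → ℝ := fun n ↦ cos (2 * π * n / Q)
  have hc : ∀ n : ℤ, (c n : ℂ) = (ω ^ n + ω ^ (-n)) / 2 := by
    intro n
    simp only [c]
    rw [Complex.ofReal_cos, Complex.cos, hωdef, ← Complex.exp_int_mul, ← Complex.exp_int_mul]
    push_cast
    congr 3 <;> ring_nf
  have hc0 : c 0 = 1 := by simp [c]
  have hch : ∀ n : ℤ, c (h + n) = -c n := by
    intro n
    have hhR : (h : ℝ) ≠ 0 := by exact_mod_cast (by omega : h ≠ 0)
    simp only [c]
    rw [← cos_add_pi]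
    congr 1
    rw [hQ]
    push_cast
    field_simp
    ring
  have hr0 : ∀ i : ℤ, 0 ≤ 1 - c i := fun i ↦ sub_nonneg.mpr (cos_le_one _)
  let δ : ℤ → ℤ → ℂ := fun a n ↦ if (Q : ℤ) ∣ n - a then 1 else 0
  have hδper : ∀ a, Function.Periodic (δ a) (Q : ℤ) := by
    intro a n
    simp only [δ, add_sub_right_comm, dvd_add_self_right]
  have hδsum : ∀ (a : ℤ) (j : ℕ), ∑ n ∈ range Q, δ a n * ω ^ ((n : ℤ) * j) = ω ^ (a * j) := by
    intro a j
    rw [← sum_range_ite_dvd_sub (Nat.pos_of_ne_zero hQ0) (hωper j) a]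
    refine sum_congr rfl fun n _ ↦ ?_
    simp only [δ, ite_mul, one_mul, zero_mul]
  have hδval : ∀ a n : ℤ, |n - a| < Q → δ a n = if n = a then 1 else 0 := by
    intro a n han
    simp only [δ]
    congr 1
    rw [← sub_eq_zero (a := n), eq_iff_iff]
    exact ⟨fun hd ↦ Int.eq_zero_of_abs_lt_dvd hd han, fun h0 ↦ h0 ▸ dvd_zero _⟩
  let ε : ℝ := 4 * ∑ i ∈ Icc 1 ℓ, (1 - c i)
  let B : ℤ → ℤ → ℂ := fun i n ↦ δ i n + δ (-i) n - δ (h + i) n - δ (h - i) n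
  refine ⟨fun n ↦ c n + ε * δ 0 n + ∑ i ∈ Icc 1 ℓ, (1 - c i : ℝ) * B i n,
    fun j ↦ Q / 2 * ((if (Q : ℤ) ∣ 1 + j then 1 else 0) + (if (Q : ℤ) ∣ -1 + j then 1 else 0)) + ε +
      ∑ i ∈ Icc 1 ℓ, (1 - c i) * (2 * c (i * j) * (1 - (-1) ^ j)), ε, ?_, ?_, ?_, ?_, ?_, ?_, ?_⟩
  · intro n
    have hcper : c (n + Q) = c n := by
      have : n + (Q : ℤ) = h + (h + n) := by rw [hQ]; push_cast; ring
      rw [this, hch, hch, neg_neg]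
    simp only [B, hcper, (hδper _) n]
  · intro j
    have h1 : -ε ≤ ∑ i ∈ Icc 1 ℓ, (1 - c i) * (2 * c (i * j) * (1 - (-1) ^ j)) := by
      simp only [ε]
      rw [mul_sum, ← sum_neg_distrib]
      refine sum_le_sum fun i _ ↦ ?_
      have h2 : -4 ≤ 2 * c (i * j) * (1 - (-1) ^ j) := by
        have h3 : -1 ≤ c (i * j) := neg_one_le_cos _
        rcases neg_one_pow_eq_or ℝ j with h | h <;> rw [h] <;> linarith
      nlinarith [hr0 i]
    have h2 : (0 : ℝ) ≤ Q / 2 * ((if (Q : ℤ) ∣ 1 + j then 1 else 0) +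
        (if (Q : ℤ) ∣ -1 + j then 1 else 0)) := by
      positivity
    linarith
  · intro j
    have hcos : ∑ n ∈ range Q, (c n : ℂ) * ω ^ ((n : ℤ) * j) = Q / 2 *
        ((if (Q : ℤ) ∣ 1 + j then 1 else 0) + (if (Q : ℤ) ∣ -1 + j then 1 else 0)) := by
      have h1 : ∀ n ∈ range Q, (c n : ℂ) * ω ^ ((n : ℤ) * j) =
          (ω ^ ((1 + j : ℤ) * n) + ω ^ ((-1 + j : ℤ) * n)) / 2 := by
        intro n _
        rw [hc, add_mul, add_mul, zpow_add₀ hω0, zpow_add₀ hω0, one_mul, neg_one_mul,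
          mul_comm (j : ℤ)]
        ring
      rw [sum_congr rfl h1, ← sum_div, sum_add_distrib, hω.sum_range_zpow, hω.sum_range_zpow]
      split_ifs <;> ring
    have hB : ∀ i : ℕ, ∑ n ∈ range Q, B i n * ω ^ ((n : ℤ) * j) =
        2 * c (i * j) * (1 - (-1) ^ j) := by
      intro i
      simp only [B, sub_mul, add_mul, sum_sub_distrib, sum_add_distrib, hδsum]
      rw [zpow_add₀ hω0, zpow_sub₀ hω0, zpow_mul ω (h : ℤ), hωh, zpow_natCast, hc, neg_mul, zpow_neg]
      ring
    simp only [add_mul, sum_add_distrib, hcos, sum_mul, mul_assoc]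
    rw [sum_comm]
    simp only [← mul_sum, hB, hδsum]
    split_ifs <;> simp [mul_assoc]
  · have h1 : ∀ i ∈ Icc 1 ℓ, 1 - c i ≤ 20 * (ℓ : ℝ) ^ 2 / Q ^ 2 := by
      intro i hi
      have hiℓ : (i : ℝ) ≤ ℓ := by exact_mod_cast (mem_Icc.mp hi).2
      have h2 := one_sub_sq_div_two_le_cos (x := 2 * π * i / Q)
      have h3 : π ^ 2 ≤ 10 := by nlinarith [pi_lt_d2, pi_pos]
      have h4 : (i : ℝ) ^ 2 ≤ (ℓ : ℝ) ^ 2 := by gcongr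
      have h5 : (2 * π * i / Q) ^ 2 / 2 ≤ 20 * (ℓ : ℝ) ^ 2 / Q ^ 2 := by
        have : (2 * π * i / Q) ^ 2 / 2 = 2 * (π ^ 2 * (i : ℝ) ^ 2) / Q ^ 2 := by
          field_simp
        rw [this]
        have h6 : π ^ 2 * (i : ℝ) ^ 2 ≤ 10 * (ℓ : ℝ) ^ 2 := by gcongr
        rw [show 20 * (ℓ : ℝ) ^ 2 = 2 * (10 * (ℓ : ℝ) ^ 2) by ring]
        gcongr 2 * ?_ / _
      simp only [c, Int.cast_natCast]
      linarith
    have h2 := sum_le_card_nsmul _ _ _ h1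
    rw [Nat.card_Icc, nsmul_eq_mul, Nat.add_sub_cancel] at h2
    calc ε ≤ 4 * (ℓ * (20 * (ℓ : ℝ) ^ 2 / Q ^ 2)) := by simp only [ε]; linarith
      _ = 80 * (ℓ : ℝ) ^ 3 / Q ^ 2 := by ring
      _ ≤ 320 * (ℓ : ℝ) ^ 3 / Q ^ 2 := by gcongr; norm_num
  · have h1 : ∀ i ∈ Icc 1 ℓ, ((1 - c i : ℝ) : ℂ) * B i 0 = 0 := by
      intro i hi
      rw [mem_Icc] at hi
      simp only [B]
      rw [hδval _ _ (by rw [abs_lt]; omega), hδval _ _ (by rw [abs_lt]; omega),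
        hδval _ _ (by rw [abs_lt]; omega), hδval _ _ (by rw [abs_lt]; omega),
        if_neg (by omega), if_neg (by omega), if_neg (by omega), if_neg (by omega)]
      simp
    simp only [sum_eq_zero h1, hc0]
    simp [δ]
  · intro n hn1 hn2
    have h1 : ∀ i ∈ Icc 1 ℓ, ((1 - c i : ℝ) : ℂ) * B i n =
        if n.toNat = i then ((1 - c n : ℝ) : ℂ) else 0 := by
      intro i hi
      rw [mem_Icc] at hi
      simp only [B]
      rw [hδval _ _ (by rw [abs_lt]; omega), hδval _ _ (by rw [abs_lt]; omega),
        hδval _ _ (by rw [abs_lt]; omega), hδval _ _ (by rw [abs_lt]; omega),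
        if_neg (c := n = -(i : ℤ)) (by omega), if_neg (c := n = h + (i : ℤ)) (by omega),
        if_neg (c := n = h - (i : ℤ)) (by omega)]
      by_cases hni : n = i
      · rw [if_pos hni, if_pos (by omega), hni]; simp
      · rw [if_neg hni, if_neg (by omega)]; simp
    beta_reduce
    rw [sum_congr rfl h1, sum_ite_eq, if_pos (by rw [mem_Icc]; omega),
      hδval _ _ (by rw [abs_lt]; omega), if_neg (by omega)]
    push_cast
    ring
  · intro n hn1 hn2
    obtain ⟨t, rfl⟩ : ∃ t : ℕ, n = h + t := ⟨(n - h).toNat, by omega⟩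
    have h1 : ∀ i ∈ Icc 1 ℓ, ((1 - c i : ℝ) : ℂ) * B i (h + t) =
        if t = i then (-(1 - c t : ℝ) : ℂ) else 0 := by
      intro i hi
      rw [mem_Icc] at hi
      simp only [B]
      rw [hδval _ _ (by rw [abs_lt]; omega), hδval _ _ (by rw [abs_lt]; omega),
        hδval _ _ (by rw [abs_lt]; omega), hδval _ _ (by rw [abs_lt]; omega),
        if_neg (c := (h + t : ℤ) = i) (by omega), if_neg (c := (h + t : ℤ) = -i) (by omega),
        if_neg (c := (h + t : ℤ) = h - i) (by omega)]
      by_cases hti : t = i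
      · rw [if_pos (by omega), if_pos hti, hti]; simp
      · rw [if_neg (by omega), if_neg hti]; simp
    beta_reduce
    rw [sum_congr rfl h1, sum_ite_eq, hδval _ _ (by rw [abs_lt]; omega), if_neg (by omega), hch]
    rcases Nat.eq_zero_or_pos t with rfl | ht
    · simp [hc0]
    · rw [if_pos (by rw [mem_Icc]; omega)]
      push_cast
      ring

/-- For every `ℓ ≥ 1` there is a threshold such that for every even `Q` beyond it and every
`k ≥ 1` there is a non-negative finite measure `σ` on the torus, supported on the
`Q^{k+1}`-th roots of unity, with `σ̂(0) ≤ 1 + 320ℓ³/Q²`, `σ̂(m) = 1` whenever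
`1 ≤ m/Q^k ≤ ℓ`, and `σ̂(m) = -1` whenever `Q/2 ≤ m/Q^k ≤ Q/2 + ℓ`. -/
theorem measure_on_roots_of_unity (ℓ : ℕ) (hℓ : 0 < ℓ) :
    ∃ Q₀ : ℕ, ∀ Q : ℕ, Even Q → Q₀ ≤ Q → ∀ k : ℕ, 0 < k →
      ∃ σ : Measure UnitAddCircle, IsFiniteMeasure σ ∧
        σ ({x : UnitAddCircle | ∃ j : ℕ, j < Q ^ (k + 1) ∧
            x = ((j : ℝ) / (Q ^ (k + 1) : ℝ) : ℝ)}ᶜ) = 0 ∧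
        (measureFourier σ 0).re ≤ 1 + 320 * (ℓ : ℝ) ^ 3 / (Q : ℝ) ^ 2 ∧
        (∀ m : ℤ, 1 ≤ (m : ℝ) / (Q : ℝ) ^ k → (m : ℝ) / (Q : ℝ) ^ k ≤ ℓ →
          measureFourier σ m = 1) ∧
        (∀ m : ℤ, (Q : ℝ) / 2 ≤ (m : ℝ) / (Q : ℝ) ^ k →
          (m : ℝ) / (Q : ℝ) ^ k ≤ (Q : ℝ) / 2 + ℓ →
          measureFourier σ m = -1) := by
  refine ⟨4 * ℓ + 2, fun Q hQeven hQ₀ k _ ↦ ?_⟩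
  obtain ⟨h, hh⟩ := hQeven
  obtain ⟨A, D, ε, hAper, hD, hAD, hε, hA0, hA1, hA2⟩ :=
    exists_cyclic_model (ℓ := ℓ) (h := h) (Q := Q) (by omega) (by omega)
  have hQ : 0 < Q := by omega
  have hM : 0 < Q ^ k := by positivity
  set M := Q ^ k with hMdef
  have hN : Q ^ (k + 1) = Q * M := pow_succ' Q k
  have hN0 : Q * M ≠ 0 := by positivity
  have hζ := Complex.isPrimitiveRoot_exp (Q * M) hN0
  have hω : ∀ n : ℤ, Complex.exp (2 * Real.pi * Complex.I / Q) ^ n =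
      Complex.exp (2 * Real.pi * Complex.I / (Q * M : ℕ)) ^ ((M : ℤ) * n) := by
    intro n
    have hMC : (M : ℂ) ≠ 0 := by exact_mod_cast hM.ne'
    rw [zpow_mul, ← Complex.exp_int_mul _ (M : ℤ)]
    congr 2
    push_cast
    field_simp
  have hconj : starRingEnd ℂ (Complex.exp (2 * Real.pi * Complex.I / (Q * M : ℕ))) =
      (Complex.exp (2 * Real.pi * Complex.I / (Q * M : ℕ)))⁻¹ := by
    rw [← Complex.exp_conj, ← Complex.exp_neg]
    congr 1
    simp [neg_div, Complex.conj_ofNat]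
  obtain ⟨w, hw, hval⟩ := exists_weights_interpolating hQ hM hζ hconj hAper hD
    (fun j ↦ by rw [hAD]; simp only [hω]; simp only [mul_assoc])
  obtain ⟨σ, hfin, hsupp, hσ⟩ := exists_measure_of_weights (N := Q * M) hw
  have hσval : ∀ (m : ℤ) (v : ℂ), (∀ n : ℤ, |m - M * n| < M → A n = v) →
      measureFourier σ m = v := fun m v hv ↦ (hσ m).trans (hval m v hv)
  have hMz : (0 : ℤ) < M := by exact_mod_cast hM
  have hMR : (0 : ℝ) < (Q : ℝ) ^ k := by positivity
  have hMcast : (Q : ℝ) ^ k = ((M : ℤ) : ℝ) := by rw [hMdef]; push_cast; rfl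
  have hQR : (Q : ℝ) / 2 = ((h : ℤ) : ℝ) := by rw [hh]; push_cast; ring
  refine ⟨σ, hfin, ?_, ?_, ?_, ?_⟩
  · rw [hN]
    convert hsupp using 8
    rw [← hN]
    push_cast
    rfl
  · rw [hσval 0 (1 + ε)]
    · simpa using hε
    · intro n hn
      have : n = 0 := by
        rw [abs_lt] at hn
        have h1 : n < 1 := by nlinarith
        have h2 : -1 < n := by nlinarith
        omega
      rw [this, hA0]
  · intro m hm1 hm2
    rw [le_div_iff₀ hMR, hMcast, one_mul] at hm1
    rw [div_le_iff₀ hMR, hMcast] at hm2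
    have hm1' : (M : ℤ) ≤ m := by exact_mod_cast hm1
    have hm2' : m ≤ (ℓ : ℤ) * M := by exact_mod_cast hm2
    refine hσval m 1 fun n hn ↦ ?_
    rw [abs_lt] at hn
    have h1 : 0 < n := by nlinarith
    have h2 : n < ℓ + 1 := by nlinarith
    exact hA1 n (by omega) (by omega)
  · intro m hm1 hm2
    rw [hQR, le_div_iff₀ hMR, hMcast] at hm1
    rw [hQR, div_le_iff₀ hMR, hMcast] at hm2
    have hm1' : (h : ℤ) * M ≤ m := by exact_mod_cast hm1
    have hm2' : m ≤ ((h : ℤ) + ℓ) * M := by exact_mod_cast hm2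
    refine hσval m (-1) fun n hn ↦ ?_
    rw [abs_lt] at hn
    have h1 : (h : ℤ) - 1 < n := by nlinarith
    have h2 : n < h + ℓ + 1 := by nlinarith
    exact hA2 n (by omega) (by omega)
end

section
/- For every j ∈ ℕ and every ε ∈ (0, 1/2) there exists a finite set R ⊆ ℕ which is a set of (1/j)-recurrence but not an ε-vdC set. -/
open MeasureTheory Finset

theorem card_mul_sum_sq_le_of_abs_sub_le_one {ι : Type*} [Fintype ι] (f : ι → ℝ)
    (hf : ∀ a b, |f a - f b| ≤ 1) :
    (Fintype.card ι : ℝ) * ∑ a, f a ^ 2 ≤ (∑ a, f a) ^ 2 + (Fintype.card ι : ℝ) ^ 2 := by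
  have h1 : ∑ a, ∑ b, (f a - f b) ^ 2 ≤ (Fintype.card ι : ℝ) ^ 2 := by
    calc ∑ a, ∑ b, (f a - f b) ^ 2 ≤ ∑ _a : ι, ∑ _b : ι, (1 : ℝ) := by
          refine sum_le_sum fun a _ => sum_le_sum fun b _ => ?_
          exact (sq_le_one_iff_abs_le_one _).2 (hf a b)
      _ = _ := by simp [sq]
  have h2 : ∑ a, ∑ b, (f a - f b) ^ 2
      = 2 * ((Fintype.card ι : ℝ) * ∑ a, f a ^ 2) - 2 * (∑ a, f a) ^ 2 := by
    have : ∀ a, ∑ b, (f a - f b) ^ 2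
        = (Fintype.card ι : ℝ) * f a ^ 2 - 2 * f a * (∑ b, f b) + ∑ b, f b ^ 2 := by
      intro a
      simp only [sub_sq, sum_add_distrib, sum_sub_distrib, ← mul_sum, sum_const, card_univ,
        nsmul_eq_mul]
    simp only [this, sum_add_distrib, sum_sub_distrib, ← mul_sum, ← sum_mul, sum_const, card_univ,
      nsmul_eq_mul]
    ring
  nlinarith [sq_nonneg (Fintype.card ι : ℝ)]

/-- An Efron–Stein inequality: a function on a product of `n` finite sets that is `1`-Lipschitz in
every coordinate has variance at most `n`. -/
theorem card_mul_sum_sq_le_of_lipschitz {n : ℕ} (α : Fin n → Type) [∀ i, Fintype (α i)]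
    [∀ i, Nonempty (α i)] (f : (∀ i, α i) → ℝ)
    (hf : ∀ x i a, |f (Function.update x i a) - f x| ≤ 1) :
    (Fintype.card (∀ i, α i) : ℝ) * ∑ x, f x ^ 2
      ≤ (∑ x, f x) ^ 2 + n * (Fintype.card (∀ i, α i) : ℝ) ^ 2 := by
  induction n with
  | zero => simp
  | succ n ih =>
    set c : ℝ := (Fintype.card (α 0) : ℝ) with hc
    set d : ℝ := (Fintype.card (∀ i : Fin n, α i.succ) : ℝ) with hd
    have hc0 : 0 < c := by rw [hc]; exact_mod_cast Fintype.card_pos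
    have hd0 : 0 < d := by rw [hd]; exact_mod_cast Fintype.card_pos
    have hcard : (Fintype.card (∀ i, α i) : ℝ) = c * d := by
      rw [← Fintype.card_congr (Fin.consEquiv α), Fintype.card_prod]; push_cast; rfl
    have hsum : ∀ g : (∀ i, α i) → ℝ,
        ∑ x, g x = ∑ y : (∀ i : Fin n, α i.succ), ∑ a : α 0, g (Fin.cons a y) := by
      intro g
      rw [← Equiv.sum_comp (Fin.consEquiv α), Fintype.sum_prod_type_right]; rfl
    set F : (∀ i : Fin n, α i.succ) → ℝ := fun y => c⁻¹ * ∑ a : α 0, f (Fin.cons a y) with hF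
    have hFs : ∀ y, ∑ a : α 0, f (Fin.cons a y) = c * F y := by
      intro y; simp only [hF]; field_simp
    have hFlip : ∀ y i a, |F (Function.update y i a) - F y| ≤ 1 := by
      intro y i a
      simp only [hF]
      rw [← mul_sub, ← sum_sub_distrib, abs_mul, abs_of_pos (inv_pos.2 hc0),
        inv_mul_le_iff₀ hc0]
      calc |∑ b : α 0, (f (Fin.cons b (Function.update y i a)) - f (Fin.cons b y))|
          ≤ ∑ b : α 0, |f (Fin.cons b (Function.update y i a)) - f (Fin.cons b y)| :=
            abs_sum_le_sum_abs _ _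
        _ ≤ ∑ _b : α 0, (1 : ℝ) := by
            refine sum_le_sum fun b _ => ?_
            have := hf (Fin.cons b y) i.succ a
            rwa [← Fin.cons_update] at this
        _ = c * 1 := by simp [hc]
    have hIH := ih (fun i => α i.succ) F hFlip
    have hrow : ∀ y, ∑ a : α 0, f (Fin.cons a y) ^ 2 ≤ c * F y ^ 2 + c := by
      intro y
      have := card_mul_sum_sq_le_of_abs_sub_le_one (fun a : α 0 => f (Fin.cons a y)) (by
        intro a b
        have := hf (Fin.cons b y) 0 a
        rwa [Fin.update_cons_zero] at this)
      simp only [hFs] at this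
      have h' : c * ∑ a : α 0, f (Fin.cons a y) ^ 2 ≤ c * (c * F y ^ 2 + c) := by
        calc _ ≤ _ := this
          _ = _ := by ring
      exact le_of_mul_le_mul_left h' hc0
    rw [hcard, hsum f, hsum (fun x => f x ^ 2)]
    simp only [hFs, ← mul_sum]
    have h3 : ∑ y : (∀ i : Fin n, α i.succ), ∑ a : α 0, f (Fin.cons a y) ^ 2
        ≤ c * ∑ y, F y ^ 2 + d * c := by
      calc _ ≤ ∑ y : (∀ i : Fin n, α i.succ), (c * F y ^ 2 + c) := sum_le_sum fun y _ => hrow y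
        _ = _ := by rw [sum_add_distrib, ← mul_sum]; simp [hd]
    calc c * d * ∑ y : (∀ i : Fin n, α i.succ), ∑ a : α 0, f (Fin.cons a y) ^ 2
        ≤ c * d * (c * ∑ y, F y ^ 2 + d * c) := by gcongr
      _ = c ^ 2 * (d * ∑ y, F y ^ 2) + (c * d) ^ 2 := by ring
      _ ≤ c ^ 2 * ((∑ y, F y) ^ 2 + n * d ^ 2) + (c * d) ^ 2 := by gcongr
      _ = _ := by push_cast; ring

/-- Two dense subsets of a product of `n` finite sets contain points that differ in `O(√n)`
coordinates. -/
theorem exists_hammingDist_le {n : ℕ} (α : Fin n → Type) [∀ i, Fintype (α i)]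
    [∀ i, Nonempty (α i)] [∀ i, DecidableEq (α i)] (A B : Finset (∀ i, α i)) (β : ℝ) (k : ℕ)
    (hβ : 0 < β) (hA : β * Fintype.card (∀ i, α i) ≤ A.card)
    (hB : β * Fintype.card (∀ i, α i) ≤ B.card) (hk : 4 * (n : ℝ) < β * k ^ 2) :
    ∃ a ∈ A, ∃ b ∈ B, hammingDist a b ≤ k := by
  by_contra! hAB
  set c : ℝ := (Fintype.card (∀ i, α i) : ℝ) with hc
  have hc0 : 0 < c := by rw [hc]; exact_mod_cast Fintype.card_pos
  have hAne : A.Nonempty := by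
    rw [← card_pos]; exact_mod_cast (mul_pos hβ hc0).trans_le hA
  set f : (∀ i, α i) → ℝ := fun x => ((A.inf' hAne fun a => hammingDist a x : ℕ) : ℝ) with hf
  have hstep : ∀ x y : (∀ i, α i), hammingDist x y ≤ 1 → f x ≤ f y + 1 := by
    intro x y hxy
    obtain ⟨a, ha, hay⟩ := A.exists_mem_eq_inf' hAne fun a => hammingDist a y
    simp only [hf, hay]
    have h1 : (A.inf' hAne fun a => hammingDist a x) ≤ hammingDist a x := inf'_le _ ha
    have h2 := hammingDist_triangle a y x
    rw [hammingDist_comm y x] at h2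
    exact_mod_cast h1.trans (h2.trans (by omega))
  have hlip : ∀ x i a, |f (Function.update x i a) - f x| ≤ 1 := by
    intro x i a
    have h1 : hammingDist (Function.update x i a) x ≤ 1 := by
      refine (card_le_card (t := {i}) fun l hl => ?_).trans (by simp)
      by_contra h
      simp_all
    have h2 := hstep _ _ h1
    have h3 := hstep _ _ ((hammingDist_comm x _).trans_le h1)
    rw [abs_le]; constructor <;> linarith
  have hvar := card_mul_sum_sq_le_of_lipschitz α f hlip
  rw [← hc] at hvar
  set m : ℝ := c⁻¹ * ∑ x, f x with hm
  have hms : ∑ x, f x = c * m := by rw [hm]; field_simp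
  have hcen : ∑ x, (f x - m) ^ 2 ≤ n * c := by
    have : ∑ x, (f x - m) ^ 2 = ∑ x, f x ^ 2 - c * m ^ 2 := by
      simp only [sub_sq, sum_add_distrib, sum_sub_distrib, ← mul_sum, ← sum_mul, hms]
      simp only [sum_const, card_univ, nsmul_eq_mul, ← hc]; ring
    rw [this]
    rw [hms] at hvar
    refine le_of_mul_le_mul_left ?_ hc0
    nlinarith
  have hfA : ∀ x ∈ A, f x = 0 := by
    intro x hx
    have : (A.inf' hAne fun a => hammingDist a x) ≤ hammingDist x x := inf'_le _ hx
    simp only [hammingDist_self, Nat.le_zero] at this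
    simp only [hf, this, Nat.cast_zero]
  have hfB : ∀ x ∈ B, (k : ℝ) ≤ f x := by
    intro x hx
    simp only [hf]
    exact_mod_cast (le_inf' hAne _ fun a ha => (hAB a ha x hx).le)
  have hm0 : 0 ≤ m := mul_nonneg (inv_nonneg.2 hc0.le) (sum_nonneg fun x _ => Nat.cast_nonneg _)
  have hk0 : (0 : ℝ) ≤ k := Nat.cast_nonneg _
  have key : ∀ (D : Finset (∀ i, α i)), β * c ≤ D.card →
      (∀ x ∈ D, k ^ 2 / 4 ≤ (f x - m) ^ 2) → False := by
    intro D hD hfD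
    have h1 : ∑ x ∈ D, (f x - m) ^ 2 ≤ ∑ x, (f x - m) ^ 2 :=
      sum_le_univ_sum_of_nonneg fun x => sq_nonneg _
    have h2 : D.card • ((k : ℝ) ^ 2 / 4) ≤ ∑ x ∈ D, (f x - m) ^ 2 := card_nsmul_le_sum _ _ _ hfD
    rw [nsmul_eq_mul] at h2
    have h3 : β * c * ((k : ℝ) ^ 2 / 4) ≤ D.card * ((k : ℝ) ^ 2 / 4) := by gcongr
    nlinarith [mul_pos hc0 (sub_pos.2 hk)]
  rcases le_or_gt (k : ℝ) (2 * m) with hkm | hkm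
  · exact key A hA fun x hx => by rw [hfA x hx]; nlinarith
  · exact key B hB fun x hx => by nlinarith [hfB x hx]

/-- Few points of `A` lie in a fibre of `p` in which `A` is sparse. -/
theorem card_filter_sparse_fiber_le {X Y : Type*} [Fintype X] [DecidableEq Y] (p : X → Y)
    (A : Finset X) {γ : ℝ} (hγ : 0 ≤ γ) :
    ((A.filter fun x => ((A.filter fun y => p y = p x).card : ℝ)
      ≤ γ * (univ.filter fun y => p y = p x).card).card : ℝ) ≤ γ * Fintype.card X := by
  set S := A.filter fun x => ((A.filter fun y => p y = p x).card : ℝ)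
      ≤ γ * (univ.filter fun y => p y = p x).card with hS
  have h1 : ∀ y ∈ S.image p, ((S.filter fun x => p x = y).card : ℝ)
      ≤ γ * (univ.filter fun x => p x = y).card := by
    intro y hy
    obtain ⟨x, hx, rfl⟩ := mem_image.1 hy
    refine le_trans ?_ (mem_filter.1 hx).2
    exact_mod_cast card_le_card (filter_subset_filter _ (filter_subset _ _))
  rw [card_eq_sum_card_image p S, ← card_univ, card_eq_sum_card_image p univ]
  push_cast
  rw [mul_sum]
  exact (sum_le_sum h1).trans (sum_le_sum_of_subset_of_nonneg (image_subset_image (subset_univ _))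
    fun y _ _ => by positivity)

/-- If every coordinate of the points of `Φ` ranges freely over `α i`, then each value of the
coordinate is taken equally rarely. -/
theorem card_mul_card_filter_le {ι : Type*} [DecidableEq ι] {α : ι → Type*}
    [∀ i, Fintype (α i)] [∀ i, DecidableEq (α i)] (Φ : Finset (∀ i, α i)) (i : ι)
    (hΦ : ∀ x ∈ Φ, ∀ a, Function.update x i a ∈ Φ) (c : α i) :
    Fintype.card (α i) * (Φ.filter fun x => x i = c).card ≤ Φ.card := by
  rw [← card_univ, ← card_product]
  refine card_le_card_of_injOn (fun z => Function.update z.2 i z.1) ?_ ?_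
  · rintro ⟨a, x⟩ h
    simp at h
    exact hΦ x h.1 a
  · rintro ⟨a, x⟩ h ⟨b, y⟩ h' hab
    simp only [coe_product, Set.mem_prod, mem_coe, mem_filter] at h h'
    have h1 : a = b := by simpa using congrFun hab i
    have h2 : x = y := by
      funext l
      by_cases hl : l = i
      · subst hl; rw [h.2.2, h'.2.2]
      · simpa [hl] using congrFun hab l
    rw [h1, h2]

/-- A dense subset of a product of large cyclic groups contains two points whose difference is
`-1` in all but exactly `k` coordinates and avoids `(-L, L)` in the remaining ones. -/
theorem exists_sub_eq_neg_one_of_dense {n : ℕ} (N : Fin n → ℕ) [∀ i, NeZero (N i)] (L k q : ℕ)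
    (β : ℝ) (hβ : 0 < β) (hk : 4 * (n : ℝ) < β * k ^ 2) (hkn : k ≤ n) (hq0 : 0 < q)
    (hq : 2 * (L : ℝ) * k * 2 ^ n ≤ β * q) (hN : ∀ i, q ≤ N i) (A : Finset (∀ i, ZMod (N i)))
    (hA : 2 * β * Fintype.card (∀ i, ZMod (N i)) ≤ A.card) :
    ∃ z ∈ A, ∃ a ∈ A, ∃ T : Finset (Fin n), T.card = k ∧ (∀ i ∉ T, a i - z i = -1) ∧
      ∀ i ∈ T, ∀ d : ℤ, |d| < L → a i - z i ≠ d := by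
  classical
  set c : ℝ := (Fintype.card (∀ i, ZMod (N i)) : ℝ) with hc
  have hc0 : 0 < c := by rw [hc]; exact_mod_cast Fintype.card_pos
  set γ : ℝ := β / 2 ^ n with hγ
  have hγ0 : 0 < γ := by positivity
  set B : Finset (∀ i, ZMod (N i)) := A.image (· + 1) with hB
  have hBA : B.card = A.card := card_image_of_injective _ (add_left_injective 1)
  set p : ∀ T : Finset (Fin n), (∀ i, ZMod (N i)) → ∀ i : {i // i ∉ T}, ZMod (N i) :=
    fun T x i => x i with hp
  set S : Finset (Fin n) → Finset (∀ i, ZMod (N i)) := fun T =>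
    B.filter fun x => ((B.filter fun y => p T y = p T x).card : ℝ)
      ≤ γ * (univ.filter fun y => p T y = p T x).card with hS
  have hScard : ((univ.biUnion S).card : ℝ) ≤ β * c := by
    calc ((univ.biUnion S).card : ℝ) ≤ ∑ T, ((S T).card : ℝ) := by exact_mod_cast card_biUnion_le
      _ ≤ ∑ _T : Finset (Fin n), γ * c :=
          sum_le_sum fun T _ => card_filter_sparse_fiber_le (p T) B hγ0.le
      _ = β * c := by
          simp only [sum_const, card_univ, Fintype.card_finset, Fintype.card_fin, nsmul_eq_mul, hγ]
          push_cast
          field_simp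
  have hB' : β * c ≤ ((B \ univ.biUnion S).card : ℝ) := by
    have h1 := le_card_sdiff (univ.biUnion S) B
    have h2 : (B.card : ℝ) ≤ (B \ univ.biUnion S).card + (univ.biUnion S).card := by
      exact_mod_cast (by omega)
    rw [hBA] at h2
    linarith
  obtain ⟨z, hz, w, hw, hzw⟩ := exists_hammingDist_le (fun i => ZMod (N i)) A
    (B \ univ.biUnion S) β k hβ (by nlinarith) hB' hk
  obtain ⟨T, hT0, hT⟩ := exists_superset_card_eq (s := univ.filter fun i => z i ≠ w i) (n := k)
    hzw (by simpa using hkn)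
  have hzT : ∀ i ∉ T, z i = w i := by
    intro i hi
    by_contra h
    exact hi (hT0 (by simpa using h))
  set Φ : Finset (∀ i, ZMod (N i)) := univ.filter fun y => p T y = p T w with hΦ
  have hwΦ : γ * Φ.card < (B.filter fun y => p T y = p T w).card := by
    by_contra! h
    refine (mem_sdiff.1 hw).2 (mem_biUnion.2 ⟨T, mem_univ _, mem_filter.2 ⟨(mem_sdiff.1 hw).1, h⟩⟩)
  set U : Finset (∀ i, ZMod (N i)) := T.biUnion fun i => (Ioo (-(L : ℤ)) L).biUnion fun d =>
    Φ.filter fun x => x i = z i + 1 + d with hU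
  have hq0' : (0 : ℝ) < q := by exact_mod_cast hq0
  have hone : ∀ i ∈ T, ∀ v : ZMod (N i), ((Φ.filter fun x => x i = v).card : ℝ) ≤ Φ.card / q := by
    intro i hi v
    have h1 := card_mul_card_filter_le Φ i (by
      intro x hx a
      simp only [hΦ, mem_filter, mem_univ, true_and] at hx ⊢
      rw [← hx]
      funext l
      have : (l : Fin n) ≠ i := fun h => l.2 (h ▸ hi)
      simp [hp, this]) v
    rw [ZMod.card] at h1
    rw [le_div_iff₀ hq0', mul_comm]
    exact_mod_cast (Nat.mul_le_mul_right _ (hN i)).trans h1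
  have hUcard : (U.card : ℝ) ≤ γ * Φ.card := by
    calc (U.card : ℝ) ≤ ∑ i ∈ T, ∑ d ∈ Ioo (-(L : ℤ)) L,
          ((Φ.filter fun x => x i = z i + 1 + d).card : ℝ) := by
          refine (Nat.cast_le.2 card_biUnion_le).trans ?_
          push_cast
          exact sum_le_sum fun i _ => by exact_mod_cast card_biUnion_le
      _ ≤ ∑ i ∈ T, ∑ d ∈ Ioo (-(L : ℤ)) L, (Φ.card : ℝ) / q :=
          sum_le_sum fun i hi => sum_le_sum fun d _ => hone i hi _
      _ = k * ((2 * L - 1 : ℕ) * (Φ.card / q)) := by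
          simp only [sum_const, hT, Int.card_Ioo, nsmul_eq_mul]
          congr 3
          omega
      _ ≤ k * ((2 * L : ℕ) * (Φ.card / q)) := by gcongr; omega
      _ ≤ γ * Φ.card := by
          rw [hγ, div_mul_eq_mul_div, le_div_iff₀ (by positivity)]
          push_cast
          rw [mul_div_assoc', mul_div_assoc', div_mul_eq_mul_div, div_le_iff₀ hq0']
          nlinarith [mul_le_mul_of_nonneg_right hq (Nat.cast_nonneg (α := ℝ) Φ.card)]
  obtain ⟨b, hb, hbU⟩ : ∃ b ∈ B.filter (fun y => p T y = p T w), b ∉ U := by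
    by_contra! h
    have : ((B.filter fun y => p T y = p T w).card : ℝ) ≤ U.card := by
      exact_mod_cast card_le_card h
    linarith
  obtain ⟨hbB, hbw⟩ := mem_filter.1 hb
  obtain ⟨a, ha, rfl⟩ := mem_image.1 hbB
  refine ⟨z, hz, a, ha, T, hT, fun i hi => ?_, fun i hi d hd h => hbU ?_⟩
  · have h1 : a i + 1 = w i := congrFun hbw ⟨i, hi⟩
    rw [hzT i hi, ← h1]; ring
  · refine mem_biUnion.2 ⟨i, hi, mem_biUnion.2 ⟨d, mem_Ioo.2 (abs_lt.1 hd), ?_⟩⟩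
    refine mem_filter.2 ⟨by simpa [hΦ] using hbw, ?_⟩
    rw [← h]; simp only [Pi.add_apply, Pi.one_apply]; ring

/-- Convex combinations of probability measures on the circle. -/
theorem exists_measureFourier_eq_sum {ι : Type*} [Fintype ι] (c : ι → ℝ) (hc : ∀ i, 0 ≤ c i)
    (hc1 : ∑ i, c i = 1) (ν : ι → Measure UnitAddCircle) (hν : ∀ i, IsProbabilityMeasure (ν i)) :
    ∃ μ : Measure UnitAddCircle, IsProbabilityMeasure μ ∧
      (∀ r, measureFourier μ r = ∑ i, c i * measureFourier (ν i) r) ∧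
      ∀ i (s : Set UnitAddCircle), c i * (ν i s).toReal ≤ (μ s).toReal := by
  have hμ : IsProbabilityMeasure (∑ i, ENNReal.ofReal (c i) • ν i) := by
    constructor
    simp only [Measure.finsetSum_apply, Measure.smul_apply, measure_univ, smul_eq_mul, mul_one]
    rw [← ENNReal.ofReal_sum_of_nonneg fun i _ => hc i, hc1, ENNReal.ofReal_one]
  refine ⟨∑ i, ENNReal.ofReal (c i) • ν i, hμ, fun r => ?_, fun i s => ?_⟩
  · simp only [measureFourier]
    rw [integral_finsetSum_measure]
    · refine sum_congr rfl fun i _ => ?_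
      rw [integral_smul_measure, ENNReal.toReal_ofReal (hc i), Complex.real_smul]
    · intro i _
      refine Integrable.smul_measure ?_ ENNReal.ofReal_ne_top
      exact (ContinuousMap.continuous _).integrable_of_hasCompactSupport
        (HasCompactSupport.of_compactSpace _)
  · have h : (ENNReal.ofReal (c i) • ν i) s ≤ (∑ i, ENNReal.ofReal (c i) • ν i) s := by
      rw [Measure.finsetSum_apply]
      exact single_le_sum (f := fun i => (ENNReal.ofReal (c i) • ν i) s)
        (fun i _ => zero_le) (mem_univ i)
    have h' := ENNReal.toReal_mono (measure_ne_top _ s) h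
    rwa [Measure.smul_apply, smul_eq_mul, ENNReal.toReal_mul, ENNReal.toReal_ofReal (hc i)] at h'

theorem measureFourier_dirac (x : ℝ) (r : ℤ) :
    measureFourier (Measure.dirac (x : UnitAddCircle)) r
      = Complex.exp (2 * Real.pi * Complex.I * (-r) * x) := by
  rw [measureFourier, integral_dirac, fourier_coe_apply]
  push_cast
  simp

theorem sum_zpow_primitiveRoot {N : ℕ} {ζ : ℂ} (hζ : IsPrimitiveRoot ζ N) (m : ℤ) :
    ∑ b : Fin N, ζ ^ (m * (b : ℕ)) = if (N : ℤ) ∣ m then (N : ℂ) else 0 := by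
  have h0 : ∑ b : Fin N, ζ ^ (m * (b : ℕ)) = ∑ b ∈ range N, (ζ ^ m) ^ b := by
    rw [← Fin.sum_univ_eq_sum_range]
    simp [zpow_mul]
  rw [h0]
  split_ifs with h
  · rw [(hζ.zpow_eq_one_iff_dvd m).2 h]; simp
  · have h1 : ζ ^ m ≠ 1 := fun h' => h ((hζ.zpow_eq_one_iff_dvd m).1 h')
    rw [geom_sum_eq h1, ← zpow_natCast, ← zpow_mul, mul_comm, zpow_mul, zpow_natCast, hζ.pow_eq_one]
    simp

/-- The measure on the `N`-th roots of unity whose Fourier coefficients are those of a Fejér kernel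
translated by `1 / 2`. -/
theorem exists_measureFourier_eq_alternating {L N : ℕ} (hL : 0 < L) (hLN : 2 * L ≤ N) :
    ∃ ν : Measure UnitAddCircle, IsProbabilityMeasure ν ∧ ∀ r : ℤ, measureFourier ν r
      = (L : ℂ)⁻¹ * ∑ l ∈ range L, ∑ m ∈ range L,
        if (N : ℤ) ∣ (l - m - r : ℤ) then (-1) ^ (l + m) else 0 := by
  have hN : 0 < N := by omega
  have hNC : (N : ℂ) ≠ 0 := by exact_mod_cast hN.ne'
  have hLC : (L : ℂ) ≠ 0 := by exact_mod_cast hL.ne'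
  set ζ : ℂ := Complex.exp (2 * Real.pi * Complex.I / N) with hζd
  have hζ : IsPrimitiveRoot ζ N := Complex.isPrimitiveRoot_exp N hN.ne'
  have hζ0 : ζ ≠ 0 := Complex.exp_ne_zero _
  have hconj : (starRingEnd ℂ) ζ = ζ⁻¹ := by
    rw [hζd, ← Complex.exp_conj, ← Complex.exp_neg]
    congr 1
    simp [neg_div, Complex.conj_ofNat]
  set P : Fin N → ℂ := fun b => ∑ l ∈ range L, (-1) ^ l * ζ ^ (l * (b : ℕ)) with hP
  set c : Fin N → ℝ := fun b => Complex.normSq (P b) / (N * L) with hc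
  have hsum : ∀ r : ℤ, ∑ b, (c b : ℂ) * ζ ^ (-r * (b : ℕ))
      = (L : ℂ)⁻¹ * ∑ l ∈ range L, ∑ m ∈ range L,
        if (N : ℤ) ∣ (l - m - r : ℤ) then (-1) ^ (l + m) else 0 := by
    intro r
    have hb : ∀ b : Fin N, (c b : ℂ) * ζ ^ (-r * (b : ℕ)) = ((N : ℂ) * L)⁻¹ *
        ∑ l ∈ range L, ∑ m ∈ range L, (-1) ^ (l + m) * ζ ^ ((l - m - r : ℤ) * (b : ℕ)) := by
      intro b
      have h1 : (c b : ℂ) = ((N : ℂ) * L)⁻¹ * (P b * (starRingEnd ℂ) (P b)) := by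
        simp only [hc]
        push_cast
        rw [Complex.normSq_eq_conj_mul_self]
        ring
      rw [h1, mul_assoc]
      congr 1
      simp only [hP, map_sum]
      rw [sum_mul_sum, sum_mul]
      simp only [sum_mul]
      refine sum_congr rfl fun l _ => sum_congr rfl fun m _ => ?_
      simp only [map_mul, map_pow, map_neg, map_one, hconj]
      have h2 : ζ ^ ((l - m - r : ℤ) * (b : ℕ))
          = ζ ^ (l * (b : ℕ)) * ζ⁻¹ ^ (m * (b : ℕ)) * ζ ^ (-r * (b : ℕ)) := by
        rw [← zpow_natCast ζ, ← zpow_natCast ζ⁻¹, inv_zpow', ← zpow_add₀ hζ0, ← zpow_add₀ hζ0]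
        congr 1
        push_cast
        ring
      rw [h2]
      ring
    simp only [hb, ← mul_sum]
    rw [sum_comm]
    have hin : ∀ l ∈ range L, ∑ b : Fin N, ∑ m ∈ range L,
        (-1) ^ (l + m) * ζ ^ ((l - m - r : ℤ) * (b : ℕ))
        = N * ∑ m ∈ range L, if (N : ℤ) ∣ (l - m - r : ℤ) then (-1) ^ (l + m) else 0 := by
      intro l _
      rw [sum_comm, mul_sum]
      refine sum_congr rfl fun m _ => ?_
      rw [← mul_sum, sum_zpow_primitiveRoot hζ]
      split_ifs <;> ring
    rw [sum_congr rfl hin, ← mul_sum]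
    field_simp
  have hc1 : ∑ b, c b = 1 := by
    have h := hsum 0
    have hd : ∀ l ∈ range L, (∑ m ∈ range L,
        if (N : ℤ) ∣ (l - m - 0 : ℤ) then (-1 : ℂ) ^ (l + m) else 0) = 1 := by
      intro l hl
      rw [sum_eq_single_of_mem l hl]
      · simp [← two_mul]
      · intro m hm hml
        rw [if_neg]
        intro hdvd
        rw [mem_range] at hl hm
        have := Int.eq_zero_of_abs_lt_dvd hdvd (by rw [abs_lt]; omega)
        omega
    rw [sum_congr rfl hd] at h
    simp [hLC] at h
    exact_mod_cast h
  obtain ⟨ν, hν, hνr, -⟩ := exists_measureFourier_eq_sum c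
    (fun b => div_nonneg (Complex.normSq_nonneg _) (by positivity)) hc1
    (fun b => Measure.dirac (((b : ℕ) / N : ℝ) : UnitAddCircle))
    fun _ => inferInstance
  refine ⟨ν, hν, fun r => ?_⟩
  rw [hνr, ← hsum]
  refine sum_congr rfl fun b _ => ?_
  rw [measureFourier_dirac, hζd, ← Complex.exp_int_mul]
  congr 2
  push_cast
  ring

/-- A probability measure whose Fourier coefficients are `-(L - 1) / L` at the integers congruent
to `±1` modulo `N`, and `0` at those not congruent to any element of `(-L, L)`. -/
theorem exists_measureFourier_eq_neg {L N : ℕ} (hL : 0 < L) (hLN : 2 * L ≤ N) :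
    ∃ ν : Measure UnitAddCircle, IsProbabilityMeasure ν ∧
      (∀ r : ℤ, (N : ℤ) ∣ r - 1 ∨ (N : ℤ) ∣ r + 1 → measureFourier ν r = -((L - 1) / L : ℝ)) ∧
      ∀ r : ℤ, (∀ d : ℤ, |d| < L → ¬ (N : ℤ) ∣ r - d) → measureFourier ν r = 0 := by
  obtain ⟨ν, hν, hνr⟩ := exists_measureFourier_eq_alternating hL hLN
  have hshift : ∀ f : ℕ → ℕ → Prop, ∀ [∀ l m, Decidable (f l m)],
      (∀ l < L, ∀ m < L, f l m ↔ l = m + 1) →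
      ∑ m ∈ range L, ∑ l ∈ range L, (if f l m then (-1 : ℂ) ^ (l + m) else 0) = -(L - 1) := by
    intro f _ hf
    have h1 : ∀ m ∈ range L, ∑ l ∈ range L, (if f l m then (-1 : ℂ) ^ (l + m) else 0)
        = if m + 1 < L then -1 else 0 := by
      intro m hm
      have : ∀ l ∈ range L, (if f l m then (-1 : ℂ) ^ (l + m) else 0)
          = if l = m + 1 then -1 else 0 := by
        intro l hl
        rw [if_congr (hf l (mem_range.1 hl) m (mem_range.1 hm)) rfl rfl]
        split_ifs with h
        · subst h; exact Odd.neg_one_pow ⟨m, by ring⟩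
        · rfl
      rw [sum_congr rfl this, sum_ite_eq']
      simp
    rw [sum_congr rfl h1]
    obtain ⟨M, rfl⟩ : ∃ M, L = M + 1 := ⟨L - 1, by omega⟩
    rw [sum_range_succ, sum_congr rfl fun m hm => if_pos (by rw [mem_range] at hm; omega)]
    simp
  have hsmall : ∀ x y : ℤ, |x| < N → (N : ℤ) ∣ y → ((N : ℤ) ∣ x + y ↔ x = 0) := by
    intro x y hx hy
    rw [dvd_add_left hy]
    exact ⟨fun h => Int.eq_zero_of_abs_lt_dvd h hx, fun h => h ▸ dvd_zero _⟩
  refine ⟨ν, hν, fun r hr => ?_, fun r hr => ?_⟩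
  · have key : ∑ l ∈ range L, ∑ m ∈ range L,
        (if (N : ℤ) ∣ (l - m - r : ℤ) then (-1 : ℂ) ^ (l + m) else 0) = -(L - 1) := by
      rcases hr with hr | hr
      · rw [sum_comm]
        refine hshift _ fun l hl m hm => ?_
        have := hsmall (l - m - 1) (-(r - 1)) (by rw [abs_lt]; omega) (dvd_neg.2 hr)
        rw [show (l - m - 1 + -(r - 1) : ℤ) = l - m - r by ring] at this
        rw [this]; omega
      · refine (sum_congr rfl fun l _ => sum_congr rfl fun m _ => ?_).trans
          (hshift (fun m l => (N : ℤ) ∣ (l - m - r : ℤ)) fun m hm l hl => ?_)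
        · rw [add_comm l m]
        · have := hsmall (l - m + 1) (-(r + 1)) (by rw [abs_lt]; omega) (dvd_neg.2 hr)
          rw [show (l - m + 1 + -(r + 1) : ℤ) = l - m - r by ring] at this
          rw [this]; omega
    rw [hνr, key]
    push_cast
    ring
  · rw [hνr, sum_eq_zero, mul_zero]
    refine fun l hl => sum_eq_zero fun m hm => if_neg fun h => ?_
    rw [mem_range] at hl hm
    refine hr (l - m) (by rw [abs_lt]; omega) ?_
    rw [← dvd_neg, neg_sub]; exact h

/-- For every `j ≥ 1` and `ε ∈ (0, 1/2)` there is a finite set `R` of positive integers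
which is a set of `(1/j)`-recurrence but not an `ε`-vdC set: some Borel probability
measure `μ` on the torus has `μ̂` vanishing on `R` but `μ({0}) > ε`. -/
theorem finite_recurrence_not_vdC (j : ℕ) (hj : 0 < j) (ε : ℝ) (hε0 : 0 < ε)
    (hε1 : ε < 1 / 2) :
    ∃ R : Finset ℕ, (∀ r ∈ R, 0 < r) ∧
      (∃ n : ℕ, 0 < n ∧ ∀ E : Finset ℕ, E ⊆ Finset.range n →
        (E.card : ℝ) > (1 / (j : ℝ)) * n → ∃ r ∈ R, ∃ m ∈ E, m + r ∈ E) ∧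
      (∃ μ : Measure UnitAddCircle, IsProbabilityMeasure μ ∧
        (∀ r ∈ R, measureFourier μ r = 0) ∧ ε < (μ {(0 : UnitAddCircle)}).toReal) := by
  classical
  have hj' : (0 : ℝ) < j := by exact_mod_cast hj
  obtain ⟨L, hL⟩ := exists_nat_gt (max 2 (2 * (1 - ε) / (1 - 2 * ε)))
  have hL2 : (2 : ℝ) < L := (le_max_left _ _).trans_lt hL
  have hLε : 2 * (1 - ε) < L * (1 - 2 * ε) :=
    (div_lt_iff₀ (by linarith)).1 ((le_max_right _ _).trans_lt hL)
  have hL0 : 0 < L := by exact_mod_cast (by linarith : (0 : ℝ) < L)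
  have hL0' : (0 : ℝ) < L := by linarith
  obtain ⟨k, hk⟩ : ∃ k, k = 16 * j ^ 2 * L := ⟨_, rfl⟩
  obtain ⟨n, hn⟩ : ∃ n, n = k * L := ⟨_, rfl⟩
  obtain ⟨q, hq⟩ : ∃ q, q = 2 * L * k * 2 ^ n * (2 * j) := ⟨_, rfl⟩
  have hk0 : 0 < k := by rw [hk]; positivity
  have hk0' : (0 : ℝ) < k := by exact_mod_cast hk0
  have hn0 : 0 < n := by rw [hn]; positivity
  have hn0' : (0 : ℝ) < n := by exact_mod_cast hn0
  have hq0 : 0 < q := by rw [hq]; positivity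
  have hkn : k ≤ n := by rw [hn]; exact Nat.le_mul_of_pos_right k hL0
  have hLq : 2 * L ≤ q := by
    rw [hq, mul_assoc, mul_assoc]
    exact Nat.le_mul_of_pos_right _ (by positivity)
  set N : Fin n → ℕ := fun i => Nat.nth Nat.Prime (q + i) with hN
  have hNp : ∀ i, (N i).Prime := fun i => Nat.prime_nth_prime _
  have hNq : ∀ i, q ≤ N i := fun i =>
    (Nat.le_add_right q i).trans (Nat.nth_strictMono Nat.infinite_setOfPred_prime).le_apply
  have hNinj : Function.Injective N := fun i i' h =>
    Fin.ext (Nat.add_left_cancel (Nat.nth_injective Nat.infinite_setOfPred_prime h))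
  have hNcop : Pairwise (Function.onFun IsCoprime fun i => (N i : ℤ)) := fun i i' h =>
    Nat.isCoprime_iff_coprime.2 ((Nat.coprime_primes (hNp i) (hNp i')).2 fun h' => h (hNinj h'))
  have : ∀ i, NeZero (N i) := fun i => ⟨(hNp i).ne_zero⟩
  set R : Finset ℕ := (range (∏ i, N i)).filter fun r => 0 < r ∧ ∃ T : Finset (Fin n),
    T.card = k ∧ (∀ i ∉ T, (N i : ℤ) ∣ r - 1 ∨ (N i : ℤ) ∣ r + 1) ∧
      ∀ i ∈ T, ∀ d : ℤ, |d| < L → ¬ (N i : ℤ) ∣ r - d with hR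
  refine ⟨R, fun r hr => (mem_filter.1 hr).2.1, ⟨∏ i, N i, prod_pos fun i _ => (hNp i).pos, ?_⟩, ?_⟩
  · intro E hE hEcard
    set e : ℕ → ∀ i, ZMod (N i) := fun m i => (m : ZMod (N i)) with he
    have hdvd : ∀ i (x y : ℕ) (d : ℤ), e x i - e y i = d ↔ (N i : ℤ) ∣ (x - y - d : ℤ) := by
      intro i x y d
      rw [← ZMod.intCast_zmod_eq_zero_iff_dvd, ← sub_eq_zero]
      push_cast
      rfl
    have hinj : Set.InjOn e E := by
      intro x hx y hy hxy
      have h1 : ((∏ i, N i : ℕ) : ℤ) ∣ (x : ℤ) - y := by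
        push_cast
        refine Fintype.prod_dvd_of_coprime hNcop fun i => ?_
        have := (hdvd i x y 0).1 (by rw [hxy]; simp)
        simpa using this
      have h2 := mem_range.1 (hE hx)
      have h3 := mem_range.1 (hE hy)
      have := Int.eq_zero_of_abs_lt_dvd h1 (by rw [abs_lt]; omega)
      omega
    obtain ⟨z, hz, a, ha, T, hT, hT1, hT2⟩ := exists_sub_eq_neg_one_of_dense N L k q (1 / (2 * j))
      (by positivity) (by
        rw [div_mul_eq_mul_div, lt_div_iff₀ (by positivity), hn, hk]
        push_cast
        have : (1 : ℝ) ≤ j := by exact_mod_cast hj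
        have h2 : (0 : ℝ) < j ^ 3 * L ^ 2 := by positivity
        nlinarith [mul_le_mul_of_nonneg_right this h2.le]) hkn hq0 (by
        rw [hq]; push_cast; apply le_of_eq; field_simp) hNq (E.image e) (by
        rw [card_image_of_injOn hinj, Fintype.card_pi]
        simp only [ZMod.card]
        refine le_trans (le_of_eq ?_) hEcard.le
        field_simp)
    obtain ⟨x, hx, rfl⟩ := mem_image.1 hz
    obtain ⟨y, hy, rfl⟩ := mem_image.1 ha
    have hT1' : ∀ i ∉ T, (N i : ℤ) ∣ (y - x : ℤ) + 1 := by
      intro i hi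
      have := (hdvd i y x (-1)).1 (by rw [hT1 i hi]; simp)
      simpa using this
    have hT2' : ∀ i ∈ T, ∀ d : ℤ, |d| < L → ¬ (N i : ℤ) ∣ (y - x : ℤ) - d :=
      fun i hi d hd h => hT2 i hi d hd ((hdvd i y x d).2 h)
    have hxN := mem_range.1 (hE hx)
    have hyN := mem_range.1 (hE hy)
    have hxy : x ≠ y := by
      rintro rfl
      obtain ⟨i, hi⟩ : T.Nonempty := card_pos.1 (hT ▸ hk0)
      exact hT2' i hi 0 (by simpa using hL0) (by simp)
    rcases lt_or_gt_of_ne hxy with h | h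
    · refine ⟨y - x, mem_filter.2 ⟨mem_range.2 (by omega), by omega, T, hT, ?_, ?_⟩, x, hx, ?_⟩
      · intro i hi
        rw [Nat.cast_sub h.le]
        exact Or.inr (hT1' i hi)
      · intro i hi
        rw [Nat.cast_sub h.le]
        exact hT2' i hi
      · rwa [Nat.add_sub_cancel' h.le]
    · refine ⟨x - y, mem_filter.2 ⟨mem_range.2 (by omega), by omega, T, hT, ?_, ?_⟩, y, hy, ?_⟩
      · intro i hi
        rw [Nat.cast_sub h.le]
        refine Or.inl ((dvd_neg.2 (hT1' i hi)).trans (dvd_of_eq ?_))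
        ring
      · intro i hi d hd hdiv
        rw [Nat.cast_sub h.le] at hdiv
        refine hT2' i hi (-d) (by rwa [abs_neg]) ((dvd_neg.2 hdiv).trans (dvd_of_eq ?_))
        ring
      · rwa [Nat.add_sub_cancel' h.le]
  · choose ν hν hν1 hν2 using fun i => exists_measureFourier_eq_neg hL0 (hLq.trans (hNq i))
    set s : ℝ := ((L - 1) / L) ^ 2 with hs
    have hs0 : 0 ≤ s := sq_nonneg _
    obtain ⟨μ, hμ, hμr, hμs⟩ := exists_measureFourier_eq_sum (ι := Option (Fin n))
      (fun o => o.elim (s / (1 + s)) fun _ => 1 / ((1 + s) * n))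
      (by rintro (_ | i) <;> simp only [Option.elim] <;> positivity)
      (by
        rw [Fintype.sum_option]
        simp only [Option.elim, sum_const, card_univ, Fintype.card_fin, nsmul_eq_mul]
        field_simp
        ring)
      (fun o => o.elim (Measure.dirac ((0 : ℝ) : UnitAddCircle)) ν)
      (by rintro (_ | i) <;> simp only [Option.elim] <;> infer_instance)
    refine ⟨μ, hμ, fun r hr => ?_, ?_⟩
    · obtain ⟨-, -, T, hT, hT1, hT2⟩ := mem_filter.1 hr
      have hsum : ∑ i, measureFourier (ν i) r = ((n - k : ℝ) * -((L - 1) / L) : ℝ) := by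
        rw [← sum_add_sum_compl T, sum_eq_zero fun i hi => hν2 i r (hT2 i hi), zero_add,
          sum_congr rfl fun i hi => hν1 i r (hT1 i (mem_compl.1 hi)), sum_const, card_compl, hT,
          Fintype.card_fin, nsmul_eq_mul, Nat.cast_sub hkn]
        push_cast
        ring
      rw [hμr, Fintype.sum_option]
      simp only [Option.elim, measureFourier_dirac, ← mul_sum, hsum]
      have hnk : (n : ℝ) = k * L := by rw [hn]; push_cast; ring
      simp only [Complex.ofReal_zero, mul_zero, Complex.exp_zero, mul_one]
      rw [← Complex.ofReal_mul, ← Complex.ofReal_add, ← Complex.ofReal_zero]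
      congr 1
      rw [hs, hnk]
      have : (1 + ((L - 1) / L : ℝ) ^ 2) ≠ 0 := by positivity
      field_simp
      ring
    · refine lt_of_lt_of_le ?_ (hμs none {0})
      simp only [Option.elim, QuotientAddGroup.mk_zero]
      rw [Measure.dirac_apply_of_mem (Set.mem_singleton _), ENNReal.toReal_one, mul_one,
        lt_div_iff₀ (by positivity)]
      have h1 : ε < (1 - ε) * s := by
        rw [hs, div_pow, ← mul_div_assoc, lt_div_iff₀ (by positivity)]
        nlinarith
      linarith
end

section
/- For every ε ∈ (0, 1/3), there exists a set R ⊆ ℕ which is a set of strong recurrence but not an ε-vdC set. In particular, there is a set of strong recurrence which is not a van der Corput set. -/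
open MeasureTheory Filter

section Cube

lemma sum_fin_succ_fin_two {M : Type*} [AddCommMonoid M] {n : ℕ} (f : (Fin (n + 1) → Fin 2) → M) :
    ∑ x, f x = ∑ x : Fin n → Fin 2, f (Fin.cons 0 x) + ∑ x : Fin n → Fin 2, f (Fin.cons 1 x) := by
  rw [← (Fin.consEquiv (fun _ : Fin (n + 1) => Fin 2)).sum_comp, Fintype.sum_prod_type,
    Fin.sum_univ_two]
  rfl

lemma hammingDist_cons {n : ℕ} {α : Type*} [DecidableEq α] (b c : α) (x y : Fin n → α) :
    hammingDist (Fin.cons b x : Fin (n + 1) → α) (Fin.cons c y) =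
      (if b = c then 0 else 1) + hammingDist x y := by
  simp only [hammingDist, Fin.card_filter_univ_succ, Fin.cons_zero, Fin.cons_succ, ne_eq]
  split_ifs <;> simp_all [add_comm]

/-- Efron–Stein inequality for Lipschitz functions on the discrete cube. -/
lemma cube_variance_le (n : ℕ) (f : (Fin n → Fin 2) → ℝ)
    (hf : ∀ x y, |f x - f y| ≤ hammingDist x y) :
    2 ^ n * ∑ x, f x ^ 2 ≤ (∑ x, f x) ^ 2 + n * 4 ^ n / 4 := by
  induction n with
  | zero => simp
  | succ n ih =>
    have h (b : Fin 2) := ih (fun x => f (Fin.cons b x)) fun x y => by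
      simpa [hammingDist_cons] using hf (Fin.cons b x) (Fin.cons b y)
    have h0 := h 0
    have h1 := h 1
    rw [sum_fin_succ_fin_two, sum_fin_succ_fin_two]
    set S0 := ∑ x : Fin n → Fin 2, f (Fin.cons 0 x)
    set S1 := ∑ x : Fin n → Fin 2, f (Fin.cons 1 x)
    have hS : |S0 - S1| ≤ 2 ^ n := by
      rw [← Finset.sum_sub_distrib]
      refine (Finset.abs_sum_le_sum_abs _ _).trans
        ((Finset.sum_le_card_nsmul _ _ 1 fun x _ => ?_).trans (by simp))
      simpa [hammingDist_cons] using hf (Fin.cons 0 x) (Fin.cons 1 x)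
    have hS' : (S0 - S1) ^ 2 ≤ 4 ^ n := by
      rw [← sq_abs]
      calc |S0 - S1| ^ 2 ≤ (2 ^ n) ^ 2 := by gcongr
        _ = 4 ^ n := by rw [← pow_mul, mul_comm, pow_mul]; norm_num
    push_cast
    rw [pow_succ, pow_succ (4 : ℝ)]
    nlinarith

lemma hammingDist_add_one {n : ℕ} (x y : Fin n → Fin 2) :
    hammingDist (x + 1) y + hammingDist x y = n := by
  have : ∀ a b : Fin 2, a + 1 ≠ b ↔ ¬ a ≠ b := by decide
  simp only [hammingDist, Pi.add_apply, Pi.one_apply, this]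
  rw [add_comm, Finset.card_filter_add_card_filter_not, Finset.card_univ, Fintype.card_fin]

/-- A dense subset of the discrete cube contains two almost antipodal points. -/
lemma exists_le_hammingDist_add {n m : ℕ} {δ : ℝ} (hδ : 0 < δ) (hm : (n : ℝ) ≤ δ * m ^ 2)
    (A : Finset (Fin n → Fin 2)) (hA : δ * 2 ^ n ≤ A.card) :
    ∃ x ∈ A, ∃ y ∈ A, n ≤ hammingDist x y + m := by
  by_contra! hcon
  have hne : A.Nonempty := by
    rw [← Finset.card_pos]
    have : (0 : ℝ) < A.card := lt_of_lt_of_le (by positivity) hA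
    exact_mod_cast this
  set d : (Fin n → Fin 2) → ℕ := fun x => A.inf' hne (hammingDist x) with hd
  have hdle (x y) : d x ≤ hammingDist x y + d y := by
    obtain ⟨z, hz, hz'⟩ := A.exists_mem_eq_inf' hne (hammingDist y)
    have hz'' : d y = hammingDist y z := hz'
    rw [hz'']
    exact (Finset.inf'_le _ hz).trans (hammingDist_triangle x y z)
  set f : (Fin n → Fin 2) → ℝ := fun x => d x
  have hvar := cube_variance_le n f fun x y => by
    have h1 : (d x : ℝ) ≤ hammingDist x y + d y := by exact_mod_cast hdle x y
    have h2 : (d y : ℝ) ≤ hammingDist x y + d x := by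
      rw [hammingDist_comm x y]; exact_mod_cast hdle y x
    rw [abs_sub_le_iff]
    constructor <;> simp only [f] <;> linarith
  have hfA (x) (hx : x ∈ A) : f x = 0 := by
    have : d x ≤ 0 := (Finset.inf'_le _ hx).trans (by simp)
    simp only [f]; exact_mod_cast Nat.le_zero.mp this
  have hfA' (x) (hx : x ∈ A) : (m : ℝ) + 1 ≤ f (x + 1) := by
    have : m + 1 ≤ d (x + 1) := Finset.le_inf' _ _ fun y hy => by
      have := hcon x hx y hy
      have := hammingDist_add_one x y
      omega
    simp only [f]; exact_mod_cast this
  set e : ℝ := (∑ x, f x) / 2 ^ n with he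
  have hS : ∑ x, f x = e * 2 ^ n := by rw [he]; field_simp
  have h4 : (4 : ℝ) ^ n = 2 ^ n * 2 ^ n := by rw [← mul_pow]; norm_num
  have hvar' : ∑ x, (f x - e) ^ 2 ≤ n * 2 ^ n / 4 := by
    have h2 : (0 : ℝ) < 2 ^ n := by positivity
    have : ∑ x, (f x - e) ^ 2 = ∑ x, f x ^ 2 - e ^ 2 * 2 ^ n := by
      simp only [sub_sq, Finset.sum_add_distrib, Finset.sum_sub_distrib]
      rw [← Finset.sum_mul, ← Finset.mul_sum, hS]
      simp; ring
    rw [this]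
    rw [hS, h4] at hvar
    have : 2 ^ n * ∑ x, f x ^ 2 ≤ 2 ^ n * (e ^ 2 * 2 ^ n + n * 2 ^ n / 4) := by linarith
    have := le_of_mul_le_mul_left this h2
    linarith
  have key (c : ℝ) (hc0 : 0 ≤ c) (B : Finset (Fin n → Fin 2)) (hB : B.card = A.card)
      (hc : ∀ x ∈ B, c ≤ (f x - e) ^ 2) : c * δ ≤ n / 4 := by
    have : c * (δ * 2 ^ n) ≤ n * 2 ^ n / 4 :=
      calc c * (δ * 2 ^ n) ≤ c * B.card := by rw [hB]; gcongr
        _ = ∑ x ∈ B, c := by simp [mul_comm]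
        _ ≤ ∑ x ∈ B, (f x - e) ^ 2 := Finset.sum_le_sum hc
        _ ≤ ∑ x, (f x - e) ^ 2 :=
          Finset.sum_le_sum_of_subset_of_nonneg (Finset.subset_univ _) fun _ _ _ => sq_nonneg _
        _ ≤ _ := hvar'
    have h2 : (0 : ℝ) < 2 ^ n := by positivity
    refine le_of_mul_le_mul_right ?_ h2
    linarith
  have he1 : e ≤ m / 2 := by
    have h1 := key (e ^ 2) (sq_nonneg e) A rfl fun x hx => by rw [hfA x hx]; simp
    have h2 : e ^ 2 * δ ≤ (m / 2 : ℝ) ^ 2 * δ := by linarith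
    exact le_of_sq_le_sq (le_of_mul_le_mul_right h2 hδ) (by positivity)
  have h1 := key ((m / 2 + 1 : ℝ) ^ 2) (sq_nonneg _) (A.map (addRightEmbedding 1)) (by simp)
    fun x hx => by
      obtain ⟨y, hy, rfl⟩ := Finset.mem_map.mp hx
      have := hfA' y hy
      simp only [addRightEmbedding_apply]
      gcongr
      linarith
  have h2 : (0 : ℝ) ≤ m := by positivity
  nlinarith [mul_nonneg h2 hδ.le]

end Cube

section Mixing

open Finset
open scoped BigOperators

lemma expect_prod {α β : Type*} [Fintype α] [Fintype β] (f : α × β → ℝ) :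
    𝔼 x, f x = 𝔼 a, 𝔼 b, f (a, b) := by
  rw [← univ_product_univ, expect_product]

lemma sq_expect_le {α : Type*} [Fintype α] (f : α → ℝ) : (𝔼 a, f a) ^ 2 ≤ 𝔼 a, f a ^ 2 := by
  rcases isEmpty_or_nonempty α with h | h
  · simp
  have h0 : 0 ≤ 𝔼 a, (f a - 𝔼 b, f b) ^ 2 := expect_nonneg fun _ _ => sq_nonneg _
  simp only [sub_sq, expect_add_distrib, expect_sub_distrib, ← expect_mul, ← mul_expect,
    expect_const univ_nonempty] at h0
  nlinarith

lemma expect_sq_marginals_le {α β : Type*} [Fintype α] [Fintype β] (f : α → β → ℝ) :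
    𝔼 a, (𝔼 b, f a b) ^ 2 + 𝔼 b, (𝔼 a, f a b) ^ 2 ≤
      𝔼 a, 𝔼 b, f a b ^ 2 + (𝔼 a, 𝔼 b, f a b) ^ 2 := by
  rcases isEmpty_or_nonempty α with h | h
  · simp
  set e := 𝔼 a, 𝔼 b, f a b with he
  have he' : 𝔼 b, 𝔼 a, f a b = e := expect_comm _ _ _
  have h1 : 𝔼 a, (𝔼 b, (f a b - 𝔼 a', f a' b)) ^ 2 ≤ 𝔼 a, 𝔼 b, (f a b - 𝔼 a', f a' b) ^ 2 :=
    expect_le_expect fun a _ => sq_expect_le _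
  have h2 : 𝔼 a, (𝔼 b, (f a b - 𝔼 a', f a' b)) ^ 2 = 𝔼 a, (𝔼 b, f a b) ^ 2 - e ^ 2 := by
    simp only [expect_sub_distrib, he', sub_sq, expect_add_distrib, ← expect_mul, ← mul_expect,
      expect_const univ_nonempty, ← he]
    ring
  have h3 : 𝔼 a, 𝔼 b, (f a b - 𝔼 a', f a' b) ^ 2 =
      𝔼 a, 𝔼 b, f a b ^ 2 - 𝔼 b, (𝔼 a, f a b) ^ 2 := by
    rw [expect_comm univ univ, expect_comm univ univ (fun a b => f a b ^ 2), ← expect_sub_distrib]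
    refine expect_congr rfl fun b _ => ?_
    simp only [expect_sub_distrib, sub_sq, expect_add_distrib, ← expect_mul, ← mul_expect,
      expect_const univ_nonempty]
    ring
  linarith

/-- A family of permutations whose averaging operator contracts the variance by a factor `c`. -/
structure IsMixing {Θ U : Type*} [Fintype Θ] [Fintype U] (σ : Θ → U → U) (c : ℝ) : Prop where
  bijective (t : Θ) : Function.Bijective (σ t)
  variance_le (f : U → ℝ) :
    𝔼 u, (𝔼 t, f (σ t u)) ^ 2 ≤ c * 𝔼 u, f u ^ 2 + (1 - c) * (𝔼 u, f u) ^ 2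

namespace IsMixing

variable {Θ Θ' U W : Type*} [Fintype Θ] [Fintype U] [Fintype Θ'] [Fintype W] {c : ℝ}

lemma expect_eq [Nonempty Θ] {σ : Θ → U → U} (h : IsMixing σ c) (f : U → ℝ) :
    𝔼 u, 𝔼 t, f (σ t u) = 𝔼 u, f u := by
  rw [expect_comm]
  have (t : Θ) : 𝔼 u, f (σ t u) = 𝔼 u, f u :=
    Fintype.expect_bijective (σ t) (h.bijective t) _ _ fun _ => rfl
  simp only [this, expect_const univ_nonempty]

lemma prodMap [Nonempty Θ'] {σ : Θ → U → U} {τ : Θ' → W → W} (hσ : IsMixing σ c)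
    (hτ : IsMixing τ c) (hc0 : 0 ≤ c) (hc1 : c ≤ 1) :
    IsMixing (fun (t : Θ × Θ') => Prod.map (σ t.1) (τ t.2)) c where
  bijective t := (hσ.bijective t.1).prodMap (hτ.bijective t.2)
  variance_le f := by
    simp only [expect_prod, Prod.map_apply]
    set h : U → W → ℝ := fun u w => 𝔼 t, f (u, τ t w) with hh
    set f₁ : U → ℝ := fun u => 𝔼 w, f (u, w)
    set f₂ : W → ℝ := fun w => 𝔼 u, f (u, w)
    set e := 𝔼 u, 𝔼 w, f (u, w) with he
    have he₂ : 𝔼 w, f₂ w = e := expect_comm _ _ _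
    have a1 : 𝔼 w, 𝔼 u, (𝔼 t, h (σ t u) w) ^ 2 ≤
        c * 𝔼 w, 𝔼 u, h u w ^ 2 + (1 - c) * 𝔼 w, (𝔼 u, h u w) ^ 2 := by
      simp only [mul_expect, ← expect_add_distrib]
      refine expect_le_expect fun w _ => ?_
      simp only [← mul_expect]
      exact hσ.variance_le fun u => h u w
    have a2 : 𝔼 u, 𝔼 w, h u w ^ 2 ≤
        c * 𝔼 u, 𝔼 w, f (u, w) ^ 2 + (1 - c) * 𝔼 u, f₁ u ^ 2 := by
      simp only [mul_expect, ← expect_add_distrib]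
      refine expect_le_expect fun u _ => ?_
      simp only [← mul_expect]
      exact hτ.variance_le fun w => f (u, w)
    have a3 : 𝔼 w, (𝔼 u, h u w) ^ 2 ≤ c * 𝔼 w, f₂ w ^ 2 + (1 - c) * e ^ 2 := by
      rw [← he₂]
      convert hτ.variance_le f₂ using 4 with w
      rw [hh, expect_comm]
    have a4 := expect_sq_marginals_le fun u w => f (u, w)
    rw [expect_comm] at a1
    rw [expect_comm univ univ fun w u => h u w ^ 2] at a1
    have b3 := mul_le_mul_of_nonneg_left a3 (sub_nonneg.2 hc1)
    have b2 := mul_le_mul_of_nonneg_left a2 hc0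
    have b4 := mul_le_mul_of_nonneg_left a4 (mul_nonneg hc0 (sub_nonneg.2 hc1))
    change 𝔼 u, 𝔼 w, (𝔼 t, h (σ t u) w) ^ 2 ≤ _
    nlinarith

lemma congr {σ : Θ → U → U} (h : IsMixing σ c) (e : Θ' ≃ Θ) (e' : W ≃ U) {τ : Θ' → W → W}
    (hτ : ∀ t w, e' (τ t w) = σ (e t) (e' w)) : IsMixing τ c where
  bijective t := by
    have : τ t = e'.symm ∘ σ (e t) ∘ e' := by ext w; simp [← hτ]
    rw [this]
    exact e'.symm.bijective.comp ((h.bijective _).comp e'.bijective)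
  variance_le f := by
    have := h.variance_le (f ∘ e'.symm)
    convert this using 3
    · refine Fintype.expect_equiv e' _ _ fun w => ?_
      congr 1
      exact Fintype.expect_equiv e _ _ fun t => by simp [← hτ]
    · exact Fintype.expect_equiv e' _ _ fun w => by simp
    · congr 1
      exact Fintype.expect_equiv e' _ _ fun w => by simp

lemma pi [Nonempty Θ] (hc0 : 0 ≤ c) (hc1 : c ≤ 1) {m : ℕ} (σ : Fin m → Θ → U → U)
    (hσ : ∀ i, IsMixing (σ i) c) :
    IsMixing (fun (t : Fin m → Θ) (u : Fin m → U) i => σ i (t i) (u i)) c := by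
  induction m with
  | zero =>
    refine ⟨fun t => ⟨fun _ _ _ => Subsingleton.elim _ _, fun u => ⟨u, Subsingleton.elim _ _⟩⟩,
      fun f => ?_⟩
    have (u : Fin 0 → U) : f u = f default := congrArg f (Subsingleton.elim _ _)
    simp only [this, expect_const univ_nonempty]
    linarith
  | succ m ih =>
    refine ((hσ 0).prodMap (ih (fun i => σ i.succ) fun i => hσ i.succ) hc0 hc1).congr
      (Fin.consEquiv fun _ => Θ).symm (Fin.consEquiv fun _ => U).symm fun t w => ?_
    ext
    · simp [Fin.consEquiv]
    · simp [Fin.consEquiv, Fin.tail]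

lemma exists_mem [Nonempty U] [Nonempty Θ] {σ : Θ → U → U} (h : IsMixing σ c) (hc0 : 0 ≤ c)
    {δ : ℝ} (hδ : 0 < δ) (hc : c < δ ^ 2) (A B : Finset U) (hA : δ * Fintype.card U ≤ A.card)
    (hB : δ * Fintype.card U ≤ B.card) : ∃ a ∈ A, ∃ t, σ t a ∈ B := by
  classical
  by_contra! hcon
  set β : ℝ := B.card / Fintype.card U with hβ
  have hU : (0 : ℝ) < Fintype.card U := by exact_mod_cast Fintype.card_pos
  have hβδ : δ ≤ β := by rw [hβ, le_div_iff₀ hU]; exact hB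
  set f : U → ℝ := fun u => if u ∈ B then 1 else 0
  have hf : 𝔼 u, f u = β := by simp [f, hβ, Fintype.expect_eq_sum_div_card]
  have hf2 : 𝔼 u, f u ^ 2 = β := by
    rw [← hf]; congr 1; ext u; simp only [f]; split_ifs <;> simp
  have h1 := h.variance_le f
  have h2 := h.expect_eq f
  set F : U → ℝ := fun u => 𝔼 t, f (σ t u)
  have h3 : 𝔼 u, (F u - β) ^ 2 ≤ c * β := by
    have : 𝔼 u, (F u - β) ^ 2 = 𝔼 u, F u ^ 2 - β ^ 2 := by
      rw [hf] at h2
      simp only [sub_sq, expect_add_distrib, expect_sub_distrib, ← expect_mul, ← mul_expect, h2,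
        expect_const univ_nonempty]
      ring
    rw [hf, hf2] at h1
    rw [this]
    nlinarith [mul_nonneg hc0 (sq_nonneg β)]
  have h4 : δ * β ^ 2 ≤ 𝔼 u, (F u - β) ^ 2 := by
    rw [Fintype.expect_eq_sum_div_card, le_div_iff₀ hU]
    calc δ * β ^ 2 * Fintype.card U = β ^ 2 * (δ * Fintype.card U) := by ring
      _ ≤ β ^ 2 * A.card := by gcongr
      _ = ∑ u ∈ A, (F u - β) ^ 2 := by
        rw [mul_comm, ← nsmul_eq_mul, ← sum_const]
        refine sum_congr rfl fun u hu => ?_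
        have : F u = 0 := expect_eq_zero fun t _ => by simp [f, hcon u hu t]
        rw [this]; ring
      _ ≤ _ := sum_le_sum_of_subset_of_nonneg (subset_univ _) fun _ _ _ => sq_nonneg _
  have h5 : δ * β ≤ c := by
    refine le_of_mul_le_mul_right ?_ (hδ.trans_le hβδ)
    linarith
  nlinarith

end IsMixing

/-- Translation by points of a parabola. -/
def parabolaShift {p : ℕ} (c t : ZMod p) (u : ZMod p × ZMod p) : ZMod p × ZMod p :=
  (u.1 + t, u.2 + (t ^ 2 + c))

lemma expect_quadratic_eq {p : ℕ} [Fact p.Prime] (hp : p ≠ 2) (C : ZMod p → ZMod p → ℝ) :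
    𝔼 h, 𝔼 t, C h (2 * t * h + h ^ 2) =
      𝔼 h, 𝔼 k, C h k + (C 0 0 - 𝔼 k, C 0 k) / p := by
  have h2 : (2 : ZMod p) ≠ 0 := Ring.two_ne_zero (by rwa [ZMod.ringChar_zmod_n])
  rw [← sub_eq_iff_eq_add', ← expect_sub_distrib, Fintype.expect_eq_sum_div_card,
    Finset.sum_eq_single 0]
  · simp [expect_const univ_nonempty]
  · intro h _ hh
    rw [sub_eq_zero]
    refine Fintype.expect_bijective (fun t => 2 * t * h + h ^ 2)
      (Finite.injective_iff_bijective.1 fun s t hst => ?_) _ _ fun _ => rfl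
    have : 2 * s * h = 2 * t * h := add_right_cancel hst
    exact mul_left_cancel₀ h2 (mul_right_cancel₀ hh this)
  · simp

lemma isMixing_parabolaShift {p : ℕ} [Fact p.Prime] (hp : p ≠ 2) (c : ZMod p) :
    IsMixing (parabolaShift c) (1 / p : ℝ) where
  bijective t := by
    refine Finite.injective_iff_bijective.1 fun u v huv => ?_
    simpa [parabolaShift, Prod.ext_iff] using huv
  variance_le f := by
    set C : ZMod p → ZMod p → ℝ := fun h k => 𝔼 u, f u * f (u + (h, k)) with hC
    have h1 : 𝔼 u, (𝔼 t, f (parabolaShift c t u)) ^ 2 = 𝔼 h, 𝔼 t, C h (2 * t * h + h ^ 2) := by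
      have h0 (u : ZMod p × ZMod p) : (𝔼 t, f (parabolaShift c t u)) ^ 2 =
          𝔼 h, 𝔼 t, f (parabolaShift c t u) * f (parabolaShift c (t + h) u) := by
        rw [sq, expect_mul_expect, expect_comm univ univ fun h t =>
          f (parabolaShift c t u) * f (parabolaShift c (t + h) u)]
        refine expect_congr rfl fun t _ => ?_
        exact (Fintype.expect_equiv (Equiv.addLeft t) _ _ fun _ => rfl).symm
      simp only [h0]
      rw [expect_comm]
      refine expect_congr rfl fun h _ => ?_
      rw [expect_comm]
      refine expect_congr rfl fun t _ => ?_
      refine Fintype.expect_equiv (Equiv.addRight (t, t ^ 2 + c)) _ _ fun u => ?_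
      simp only [parabolaShift, Equiv.coe_addRight]
      congr 2
      ext <;> simp <;> ring
    have h2 : 𝔼 h, 𝔼 k, C h k = (𝔼 u, f u) ^ 2 := by
      simp only [hC]
      rw [← expect_prod fun x : ZMod p × ZMod p => 𝔼 u, f u * f (u + (x.1, x.2)), sq,
        expect_mul_expect, expect_comm]
      refine expect_congr rfl fun u _ => ?_
      exact Fintype.expect_equiv (Equiv.addLeft u) _ _ fun _ => rfl
    have h3 : C 0 0 = 𝔼 u, f u ^ 2 := by
      simp only [hC, ← Prod.zero_eq_mk, add_zero, sq]
    have h4 : (𝔼 u, f u) ^ 2 ≤ 𝔼 k, C 0 k := by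
      have : 𝔼 k, C 0 k = 𝔼 x, (𝔼 y, f (x, y)) ^ 2 := by
        simp only [hC, expect_prod]
        rw [expect_comm]
        refine expect_congr rfl fun x _ => ?_
        rw [sq, expect_mul_expect, expect_comm]
        refine expect_congr rfl fun y _ => ?_
        exact Fintype.expect_equiv (Equiv.addLeft y) _ _ fun _ => by simp
      rw [this, expect_prod]
      exact sq_expect_le _
    rw [h1, expect_quadratic_eq hp, h2, h3]
    have h5 : (0 : ℝ) ≤ 1 / p := by positivity
    have h6 := mul_le_mul_of_nonneg_left h4 h5
    have h7 : (𝔼 u, f u ^ 2 - 𝔼 k, C 0 k) / p = 1 / p * (𝔼 u, f u ^ 2) - 1 / p * 𝔼 k, C 0 k := by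
      ring
    rw [h7]
    linarith

end Mixing

section CutPolytope

open Finset
open scoped BigOperators

/-- The convex hull of the matrices `(g, h) ↦ (-1) ^ (s g + s h)`. -/
def cutPolytope (V : Type*) : Set (V → V → ℝ) :=
  convexHull ℝ (Set.range fun (s : V → Fin 2) (g h : V) =>
    (-1 : ℝ) ^ (s g : ℕ) * (-1 : ℝ) ^ (s h : ℕ))

lemma convex_cutPolytope (V : Type*) : Convex ℝ (cutPolytope V) := convex_convexHull _ _

lemma cutPolytope_comap {V W : Type*} (π : W → V) {k : V → V → ℝ} (hk : k ∈ cutPolytope V) :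
    (fun a b => k (π a) (π b)) ∈ cutPolytope W := by
  let L : (V → V → ℝ) →ₗ[ℝ] (W → W → ℝ) :=
    { toFun := fun k a b => k (π a) (π b)
      map_add' := fun _ _ => rfl
      map_smul' := fun _ _ => rfl }
  have : cutPolytope V ⊆ L ⁻¹' cutPolytope W := by
    refine convexHull_min ?_ ((convex_cutPolytope W).linear_preimage L)
    rintro _ ⟨s, rfl⟩
    exact subset_convexHull _ _ ⟨s ∘ π, rfl⟩
  exact this hk

lemma one_mem_cutPolytope (V : Type*) : (fun _ _ => 1) ∈ cutPolytope V :=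
  subset_convexHull _ _ ⟨fun _ => 0, by simp⟩

lemma cutPolytope_expect {V ι : Type*} {s : Finset ι} (hs : s.Nonempty) {k : ι → V → V → ℝ}
    (hk : ∀ i ∈ s, k i ∈ cutPolytope V) : (fun a b => 𝔼 i ∈ s, k i a b) ∈ cutPolytope V := by
  have h0 : (s.card : ℝ) ≠ 0 := by simpa using hs.ne_empty
  have := (convex_cutPolytope V).sum_mem (t := s) (w := fun _ => (s.card : ℝ)⁻¹) (z := k)
    (fun _ _ => by positivity) (by simp [h0]) hk
  convert this using 3 with a b
  rw [expect_eq_sum_div_card]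
  simp [div_eq_inv_mul, mul_sum]

lemma diagonal_mem_cutPolytope (V : Type*) [Fintype V] [DecidableEq V] :
    (fun a b => if a = b then 1 else 0) ∈ cutPolytope V := by
  have := cutPolytope_expect (V := V) (s := (univ : Finset (V → Fin 2))) univ_nonempty
    (k := fun s a b => (-1 : ℝ) ^ (s a : ℕ) * (-1 : ℝ) ^ (s b : ℕ))
    fun s _ => subset_convexHull _ _ ⟨s, rfl⟩
  convert this using 3 with a b
  split_ifs with hab
  · subst hab
    have h (s : V → Fin 2) : (-1 : ℝ) ^ (s a : ℕ) * (-1 : ℝ) ^ (s a : ℕ) = 1 := by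
      rw [← mul_pow]; simp
    simp only [h, expect_const univ_nonempty]
  · have h := Fintype.expect_bijective (fun s : V → Fin 2 => s + Pi.single a 1)
      (AddGroup.addRight_bijective _)
      (fun s => (-1 : ℝ) ^ (s a : ℕ) * (-1 : ℝ) ^ (s b : ℕ))
      (fun s => - ((-1 : ℝ) ^ (s a : ℕ) * (-1 : ℝ) ^ (s b : ℕ))) fun s => by
        have h1 : ∀ x : Fin 2, (-1 : ℝ) ^ ((x + 1 : Fin 2) : ℕ) = - (-1 : ℝ) ^ (x : ℕ) := by
          intro x; fin_cases x <;> simp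
        simp [h1, Ne.symm hab]
    rw [expect_neg_distrib] at h
    linarith

lemma hammingDist_mem_cutPolytope {n : ℕ} (hn : n ≠ 0) :
    (fun x y : Fin n → Fin 2 => 1 - 2 * (hammingDist x y : ℝ) / n) ∈
      cutPolytope (Fin n → Fin 2) := by
  have : NeZero n := ⟨hn⟩
  have := cutPolytope_expect (V := Fin n → Fin 2) (s := (univ : Finset (Fin n))) univ_nonempty
    (k := fun i x y => (-1 : ℝ) ^ (x i : ℕ) * (-1 : ℝ) ^ (y i : ℕ))
    fun i _ => subset_convexHull _ _ ⟨fun x => x i, rfl⟩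
  convert this using 3 with x y
  have h (i : Fin n) : (-1 : ℝ) ^ (x i : ℕ) * (-1 : ℝ) ^ (y i : ℕ) =
      1 - 2 * if x i ≠ y i then 1 else 0 := by
    have : ∀ a b : Fin 2, (-1 : ℝ) ^ (a : ℕ) * (-1 : ℝ) ^ (b : ℕ) =
      1 - 2 * if a ≠ b then 1 else 0 := by
      intro a b; fin_cases a <;> fin_cases b <;> simp <;> norm_num
    exact this _ _
  rw [Fintype.expect_eq_sum_div_card]
  simp only [h, sum_sub_distrib, ← mul_sum, sum_boole, hammingDist]
  have : (n : ℝ) ≠ 0 := by exact_mod_cast hn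
  simp
  field_simp

/-- Two disjoint relations are separated by a point of the cut polytope. -/
lemma exists_mem_cutPolytope_separating {U : Type*} [Finite U] (E F : U → U → Prop)
    (hE : ∃ u v, E u v) (hEne : ∀ u v, E u v → u ≠ v) (hFne : ∀ u v, F u v → u ≠ v)
    (hEF : ∀ u v, F u v → ¬ E u v ∧ ¬ E v u) :
    ∃ κ : ℝ, 0 < κ ∧ ∃ k ∈ cutPolytope U,
      (∀ u v, E u v → k u v = κ) ∧ ∀ u v, F u v → k u v = 0 := by
  classical
  have := Fintype.ofFinite U
  set S : Finset (U × U) := {e | E e.1 e.2 ∨ E e.2 e.1} with hS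
  have hSne : S.Nonempty := by
    obtain ⟨u, v, h⟩ := hE
    exact ⟨(u, v), by simp [hS, h]⟩
  have hk := cutPolytope_expect hSne (k := fun e a b =>
    if (if a = e.1 then e.2 else a) = (if b = e.1 then e.2 else b) then 1 else 0)
    fun e _ => cutPolytope_comap (fun a => if a = e.1 then e.2 else a)
      (diagonal_mem_cutPolytope U)
  have hval (a b : U) (hab : a ≠ b) : 𝔼 e ∈ S, (if (if a = e.1 then e.2 else a) =
      (if b = e.1 then e.2 else b) then (1 : ℝ) else 0) =
      ((if (a, b) ∈ S then 1 else 0) + if (b, a) ∈ S then 1 else 0) / S.card := by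
    rw [expect_eq_sum_div_card, ← sum_ite_eq' S (a, b) fun _ => (1 : ℝ),
      ← sum_ite_eq' S (b, a) fun _ => (1 : ℝ), ← sum_add_distrib]
    congr 1
    refine sum_congr rfl fun e he => ?_
    obtain ⟨c, d⟩ := e
    have hcd : c ≠ d := by
      simp only [hS, mem_filter, mem_univ, true_and] at he
      exact he.elim (hEne _ _) fun h => (hEne _ _ h).symm
    simp only [Prod.mk.injEq]
    grind
  have hcard : (0 : ℝ) < S.card := by exact_mod_cast hSne.card_pos
  refine ⟨2 / S.card, by positivity, _, hk, fun u v h => ?_, fun u v h => ?_⟩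
  · rw [hval u v (hEne u v h), if_pos (by simp [hS, h]), if_pos (by simp [hS, h])]
    norm_num
  · have := hEF u v h
    rw [hval u v (hFne u v h), if_neg (by simp [hS, this]), if_neg (by simp [hS, this])]
    norm_num

end CutPolytope

section Graph

open Finset
open scoped BigOperators

lemma exists_parabola_mem_cutPolytope {p : ℕ} [Fact p.Prime] (hp : 3 < p) :
    ∃ c₁ c₂ : ZMod p, ∃ κ : ℝ, 0 < κ ∧ ∃ k ∈ cutPolytope (ZMod p × ZMod p),
      (∀ t u, k u (parabolaShift c₁ t u) = κ) ∧ ∀ t u, k u (parabolaShift c₂ t u) = 0 := by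
  have h2 : (2 : ZMod p) ≠ 0 := Ring.two_ne_zero (by rw [ZMod.ringChar_zmod_n]; omega)
  have h3 : (3 : ZMod p) ≠ 0 := by
    intro h
    have := (ZMod.natCast_eq_zero_iff 3 p).1 (by exact_mod_cast h)
    have := Nat.le_of_dvd (by norm_num) this
    omega
  obtain ⟨ν, hν⟩ := FiniteField.exists_nonsquare (F := ZMod p)
    (by rw [ZMod.ringChar_zmod_n]; omega)
  have hν0 : ν ≠ 0 := by rintro rfl; exact hν (by simp)
  have hE (u v) (h : ∃ t, parabolaShift ν t u = v) : u ≠ v := by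
    obtain ⟨t, rfl⟩ := h
    intro h
    simp only [parabolaShift, Prod.ext_iff, left_eq_add] at h
    obtain ⟨rfl, h⟩ := h
    simp_all
  have hF (u v) (h : ∃ t, parabolaShift (-3 * ν) t u = v) : u ≠ v := by
    obtain ⟨t, rfl⟩ := h
    intro h
    simp only [parabolaShift, Prod.ext_iff, left_eq_add] at h
    obtain ⟨rfl, h⟩ := h
    simp_all
  have hEF (u v) (h : ∃ t, parabolaShift (-3 * ν) t u = v) :
      (¬ ∃ t, parabolaShift ν t u = v) ∧ ¬ ∃ t, parabolaShift ν t v = u := by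
    obtain ⟨t, rfl⟩ := h
    constructor
    · rintro ⟨s, h⟩
      simp only [parabolaShift, Prod.ext_iff, add_right_inj] at h
      obtain ⟨rfl, h⟩ := h
      have : 2 * (2 * ν) = 0 := by linear_combination h
      exact mul_ne_zero h2 (mul_ne_zero h2 hν0) this
    · rintro ⟨s, h⟩
      simp only [parabolaShift, Prod.ext_iff] at h
      obtain ⟨h, h'⟩ := h
      have hs : s = -t := by linear_combination h
      subst hs
      have : 2 * (t * t - ν) = 0 := by linear_combination h'
      refine hν ⟨t, ?_⟩
      rcases mul_eq_zero.1 this with h | h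
      · exact absurd h h2
      · exact (sub_eq_zero.1 h).symm
  obtain ⟨κ, hκ, k, hk, hkE, hkF⟩ :=
    exists_mem_cutPolytope_separating _ _ ⟨0, _, 0, rfl⟩ hE hF hEF
  exact ⟨ν, -3 * ν, κ, hκ, k, hk, fun t u => hkE _ _ ⟨t, rfl⟩, fun t u => hkF _ _ ⟨t, rfl⟩⟩

/-- A dense subset of a product has many dense fibres. -/
lemma card_dense_fibres {α β : Type*} [Fintype α] [Fintype β] [Nonempty β] [DecidableEq α]
    [DecidableEq β] {δ : ℝ} (hδ : 0 ≤ δ) (A : Finset (α × β))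
    (hA : δ * (Fintype.card α * Fintype.card β) ≤ A.card) :
    δ / 2 * Fintype.card α ≤ #{x : α | δ / 2 * Fintype.card β ≤ #{w : β | (x, w) ∈ A}} := by
  set A' : Finset α := {x : α | δ / 2 * Fintype.card β ≤ #{w : β | (x, w) ∈ A}} with hA'
  have hβ : (0 : ℝ) < Fintype.card β := by exact_mod_cast Fintype.card_pos
  have hsum : A.card = ∑ x, #{w : β | (x, w) ∈ A} := by
    rw [card_eq_sum_card_fiberwise (f := Prod.fst) (t := univ) (by simp)]
    refine sum_congr rfl fun x _ => ?_
    refine card_nbij' Prod.snd (fun w => (x, w)) ?_ ?_ ?_ ?_ <;>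
      simp +contextual [Set.MapsTo, Set.LeftInvOn]
    grind
  have h1 : (A.card : ℝ) ≤
      ∑ x, ((if x ∈ A' then (Fintype.card β : ℝ) else 0) + δ / 2 * Fintype.card β) := by
    rw [hsum, Nat.cast_sum]
    refine sum_le_sum fun x _ => ?_
    split_ifs with hx
    · have : (#{w : β | (x, w) ∈ A} : ℝ) ≤ Fintype.card β := by exact_mod_cast card_le_univ _
      have : 0 ≤ δ / 2 * Fintype.card β := by positivity
      linarith
    · have : ¬ δ / 2 * Fintype.card β ≤ #{w : β | (x, w) ∈ A} := by simpa [hA'] using hx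
      linarith
  rw [sum_add_distrib, sum_ite_mem, univ_inter, sum_const, sum_const, nsmul_eq_mul, nsmul_eq_mul,
    card_univ] at h1
  refine le_of_mul_le_mul_right ?_ hβ
  linarith

/-- Every dense set of vertices contains an edge of weight exactly `-1/2`. -/
lemma exists_mem_cutPolytope_dense_edge {δ : ℝ} (hδ : 0 < δ) :
    ∃ N : ℕ, ∃ k ∈ cutPolytope (Fin N), ∀ A : Finset (Fin N), δ * N ≤ A.card →
      ∃ g ∈ A, ∃ h ∈ A, k g h = -1 / 2 := by
  obtain ⟨p, hp, hpp⟩ := Nat.exists_infinite_primes (4 + (⌈1 / (δ / 2) ^ 2⌉₊ + 1))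
  have : Fact p.Prime := ⟨hpp⟩
  have hδ' : 0 < δ / 2 := by positivity
  have hp0 : (0 : ℝ) < p := by exact_mod_cast hpp.pos
  have hpδ : (1 / p : ℝ) < (δ / 2) ^ 2 := by
    rw [div_lt_comm₀ hp0 (by positivity)]
    refine (Nat.le_ceil _).trans_lt ?_
    exact_mod_cast (by omega : ⌈1 / (δ / 2) ^ 2⌉₊ < p)
  have hp1 : (1 / p : ℝ) ≤ 1 := by
    rw [div_le_one hp0]; exact_mod_cast hpp.one_lt.le
  obtain ⟨c₁, c₂, κ, hκ, kU, hkU, hc₁, hc₂⟩ := exists_parabola_mem_cutPolytope (p := p) (by omega)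
  set K : ℕ := 8 + ⌈8 / κ⌉₊ with hK
  have hK8 : (8 : ℝ) ≤ K := by rw [hK]; push_cast; linarith [Nat.cast_nonneg (α := ℝ) ⌈8 / κ⌉₊]
  have hKκ : 8 ≤ K * κ := by
    rw [← div_le_iff₀ hκ, hK]; push_cast; linarith [Nat.le_ceil (8 / κ)]
  set m : ℕ := ⌈K / (δ / 2)⌉₊ + 1 with hm
  have hmK : K ≤ δ / 2 * m := by
    rw [← div_le_iff₀' hδ', hm]; push_cast; linarith [Nat.le_ceil (K / (δ / 2))]
  have hm0 : (0 : ℝ) < m := by rw [hm]; positivity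
  set n : ℕ := K * m with hn
  have hn0 : n ≠ 0 := by rw [hn, hm]; positivity
  have hnm : (n : ℝ) ≤ δ / 2 * m ^ 2 := by rw [hn]; push_cast; nlinarith
  let U := ZMod p × ZMod p
  let W := Fin m → U
  let V := (Fin n → Fin 2) × W
  have hk₁ : (fun a b : V => 1 - 2 * (hammingDist a.1 b.1 : ℝ) / n) ∈ cutPolytope V :=
    cutPolytope_comap Prod.fst (hammingDist_mem_cutPolytope hn0)
  have : NeZero m := ⟨by rw [hm]; omega⟩
  have hk₂ : (fun a b : V => 𝔼 i, kU (a.2 i) (b.2 i)) ∈ cutPolytope V :=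
    cutPolytope_expect univ_nonempty fun i _ => cutPolytope_comap (fun a : V => a.2 i) hkU
  set θ : ℝ := κ / (κ + 2 / K) with hθ
  have hK0 : (0 : ℝ) < K := by linarith
  have hθ0 : 0 ≤ θ := by positivity
  have hθ1 : θ ≤ 1 := by rw [hθ, div_le_one (by positivity)]; simp; positivity
  have hθ' : 4 / 5 ≤ θ := by
    rw [hθ, le_div_iff₀ (by positivity)]
    have : 2 / K ≤ κ / 4 := by rw [div_le_iff₀ hK0]; linarith
    linarith
  have hθK : 2 * θ / K = (1 - θ) * κ := by rw [hθ]; field_simp; ring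
  set η : ℝ := θ - 2 * θ / K with hη
  have hη1 : 1 / 2 ≤ η := by
    have : 2 * θ / K ≤ θ / 4 := by rw [div_le_iff₀ hK0]; nlinarith
    linarith
  set s : ℝ := (η - 1 / 2) / (1 + η) with hs
  have hs0 : 0 ≤ s := div_nonneg (by linarith) (by linarith)
  have hs1 : s ≤ 1 := by rw [hs, div_le_one (by linarith)]; linarith
  have hk := convex_cutPolytope V (convex_cutPolytope V hk₁ hk₂ hθ0 (sub_nonneg.2 hθ1) (by ring))
    (one_mem_cutPolytope V) (sub_nonneg.2 hs1) hs0 (by ring)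
  set k := (1 - s) • (θ • (fun a b : V => 1 - 2 * (hammingDist a.1 b.1 : ℝ) / n) +
    (1 - θ) • (fun a b : V => 𝔼 i, kU (a.2 i) (b.2 i))) + s • fun _ _ => 1 with hkdef
  have hcardV : Fintype.card V = 2 ^ n * Fintype.card W := by simp [V]
  have hdense (A : Finset V) (hA : δ * Fintype.card V ≤ A.card) :
      ∃ g ∈ A, ∃ h ∈ A, k g h = -1 / 2 := by
    classical
    have hA' := card_dense_fibres hδ.le A (by rw [hcardV] at hA; simpa using hA)
    obtain ⟨x, hx, y, hy, hxy⟩ := exists_le_hammingDist_add hδ' hnm _ (by simpa using hA')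
    simp only [mem_filter, mem_univ, true_and] at hx hy
    obtain ⟨e, he⟩ : ∃ e, n = hammingDist x y + e :=
      Nat.exists_eq_add_of_le (by simpa using hammingDist_le_card_fintype (x := x) (y := y))
    have hem : e ≤ m := by omega
    obtain ⟨a, ha, t, hat⟩ := (IsMixing.pi (by positivity) hp1
      (fun i : Fin m => parabolaShift (if i.val < m - e then c₁ else c₂)) fun i =>
        isMixing_parabolaShift (by omega) _).exists_mem (by positivity) hδ' hpδ _ _ hx hy
    simp only [mem_filter, mem_univ, true_and] at ha hat
    refine ⟨_, ha, _, hat, ?_⟩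
    have hE : 𝔼 i, kU (a i) (parabolaShift (if i.val < m - e then c₁ else c₂) (t i) (a i)) =
        κ * (1 - e / m) := by
      have h (i : Fin m) : kU (a i) (parabolaShift (if i.val < m - e then c₁ else c₂) (t i) (a i))
          = if i.val < m - e then κ else 0 := by split_ifs <;> simp [hc₁, hc₂]
      simp only [h]
      rw [Fintype.expect_eq_sum_div_card, ← sum_filter, sum_const, Fin.card_filter_val_lt]
      rw [min_eq_right (by omega)]
      simp only [nsmul_eq_mul, Fintype.card_fin, Nat.cast_sub hem]
      field_simp
    have hD : 1 - 2 * (hammingDist x y : ℝ) / n = -1 + 2 * (e / m) / K := by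
      have h1 : (hammingDist x y : ℝ) = n - e := by
        have : (n : ℝ) = hammingDist x y + e := by exact_mod_cast he
        linarith
      rw [h1, hn]; push_cast; field_simp; ring
    simp only [hkdef, Pi.add_apply, Pi.smul_apply, smul_eq_mul, hE, hD]
    have : θ * (-1 + 2 * (e / m) / K) + (1 - θ) * (κ * (1 - e / m)) = -η := by
      rw [hη]
      linear_combination (1 - (e : ℝ) / m) * (-1) * hθK
    rw [this, hs]
    field_simp
    ring
  have eV := (Fintype.equivFin V).symm
  refine ⟨Fintype.card V, _, cutPolytope_comap eV hk, fun A hA => ?_⟩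
  obtain ⟨g, hg, h, hh, hgh⟩ := hdense (A.map eV.toEmbedding) (by simpa using hA)
  rw [Finset.mem_map] at hg hh
  obtain ⟨g, hg, rfl⟩ := hg
  obtain ⟨h, hh, rfl⟩ := hh
  exact ⟨g, hg, h, hh, hgh⟩

end Graph

section Recurrence

open Finset

/-- If every dense set of indices contains an edge, then among events of large probability some
edge joins two events with a substantial intersection. -/
lemma exists_edge_le_measureReal_inter {X : Type*} [MeasurableSpace X] {μ : Measure X}
    [IsProbabilityMeasure μ] {N : ℕ} {E : Fin N → Fin N → Prop} {δ a c : ℝ}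
    (hδ : 0 ≤ δ) (hc0 : 0 ≤ c)
    (hE : ∀ A : Finset (Fin N), δ * N ≤ A.card → ∃ g ∈ A, ∃ h ∈ A, E g h)
    (B : Fin N → Set X) (hB : ∀ i, MeasurableSet (B i)) (hBa : ∀ i, a ≤ μ.real (B i))
    (hc : δ + N ^ 2 * c < a) : ∃ g h, E g h ∧ c ≤ μ.real (B g ∩ B h) := by
  classical
  by_contra! hcon
  have hN : 0 < N := by
    by_contra! hN
    obtain rfl : N = 0 := by omega
    obtain ⟨g, -⟩ := hE ∅ (by simp)
    exact g.elim0
  have hN' : (0 : ℝ) < N := by exact_mod_cast hN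
  set S : Finset (Fin N × Fin N) := {e | E e.1 e.2} with hS
  have hpt (x : X) : ∑ i, (B i).indicator 1 x ≤
      δ * N + N * ∑ e ∈ S, (B e.1 ∩ B e.2).indicator (1 : X → ℝ) x := by
    have h0 (e : Fin N × Fin N) : 0 ≤ (B e.1 ∩ B e.2).indicator (1 : X → ℝ) x :=
      Set.indicator_nonneg (by simp) _
    have h1 : ∑ i, (B i).indicator (1 : X → ℝ) x = #{i | x ∈ B i} := by
      simp [Set.indicator_apply]
    rw [h1]
    by_cases hd : δ * N ≤ #{i | x ∈ B i}
    · obtain ⟨g, hg, h, hh, hgh⟩ := hE _ hd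
      simp only [mem_filter, mem_univ, true_and] at hg hh
      have h2 : 1 ≤ ∑ e ∈ S, (B e.1 ∩ B e.2).indicator (1 : X → ℝ) x := by
        refine le_trans ?_ (single_le_sum (fun e _ => h0 e)
          (show (g, h) ∈ S by simpa [hS] using hgh))
        simp [hg, hh]
      have h3 : (#{i | x ∈ B i} : ℝ) ≤ N := by
        exact_mod_cast (card_le_univ _).trans (by simp)
      nlinarith
    · have : 0 ≤ ∑ e ∈ S, (B e.1 ∩ B e.2).indicator (1 : X → ℝ) x := sum_nonneg fun e _ => h0 e
      nlinarith
  have hind (s : Set X) (hs : MeasurableSet s) : Integrable (s.indicator (1 : X → ℝ)) μ :=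
    (integrable_const 1).indicator hs
  have h4 := integral_mono (μ := μ) (integrable_finsetSum _ fun i _ => hind _ (hB i))
    ((integrable_const _).add ((integrable_finsetSum _ fun e _ =>
      hind _ ((hB e.1).inter (hB e.2))).const_mul _)) hpt
  rw [integral_finsetSum _ fun i _ => hind _ (hB i),
    integral_add' (integrable_const _) ((integrable_finsetSum _ fun e _ =>
      hind _ ((hB e.1).inter (hB e.2))).const_mul _), integral_const_mul, integral_const_mul,
    integral_finsetSum _ fun e _ => hind _ ((hB e.1).inter (hB e.2))] at h4
  simp only [integral_indicator_one (hB _), integral_indicator_one ((hB _).inter (hB _)),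
    integral_const, probReal_univ, smul_eq_mul, one_mul] at h4
  have h5 : N * a ≤ ∑ i, μ.real (B i) := by
    simpa using card_nsmul_le_sum univ (fun i => μ.real (B i)) a fun i _ => hBa i
  have h6 : ∑ e ∈ S, μ.real (B e.1 ∩ B e.2) ≤ N ^ 2 * c := by
    calc ∑ e ∈ S, μ.real (B e.1 ∩ B e.2) ≤ ∑ e ∈ S, c :=
          sum_le_sum fun e he => (hcon _ _ (by simpa [hS] using he)).le
      _ = #S * c := by simp
      _ ≤ N ^ 2 * c := by
        gcongr
        have := card_le_univ S
        simp only [Fintype.card_prod, Fintype.card_fin] at this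
        exact_mod_cast this.trans_eq (sq N).symm
  nlinarith

lemma exists_edge_le_measureReal_inter_preimage {X : Type*} [MeasurableSpace X] {μ : Measure X}
    [IsProbabilityMeasure μ] {T : X → X} (hT : MeasurePreserving T μ μ) {A : Set X}
    (hA : MeasurableSet A) {N : ℕ} {E : Fin N → Fin N → Prop} {δ c : ℝ} (hδ : 0 ≤ δ) (hc0 : 0 ≤ c)
    (hE : ∀ A : Finset (Fin N), δ * N ≤ A.card → ∃ g ∈ A, ∃ h ∈ A, E g h)
    (hsymm : ∀ g h, E g h → E h g) (hirrefl : ∀ g, ¬ E g g)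
    (hc : δ + N ^ 2 * c < μ.real A) {M : Fin N → ℕ} (hM : Monotone M) :
    ∃ g h, g < h ∧ E g h ∧ c ≤ μ.real (A ∩ T^[M h - M g] ⁻¹' A) := by
  have hmp (i : ℕ) : MeasurePreserving T^[i] μ μ := hT.iterate i
  have hlt (g h) (hgh : g < h) :
      μ.real (T^[M g] ⁻¹' A ∩ T^[M h] ⁻¹' A) = μ.real (A ∩ T^[M h - M g] ⁻¹' A) := by
    have : T^[M h] = T^[M h - M g] ∘ T^[M g] := by
      rw [← Function.iterate_add, Nat.sub_add_cancel (hM hgh.le)]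
    rw [this, Set.preimage_comp, ← Set.preimage_inter,
      (hmp _).measureReal_preimage (hA.inter ((hmp _).measurable hA)).nullMeasurableSet]
  obtain ⟨g, h, hgh, hle⟩ := exists_edge_le_measureReal_inter hδ hc0 hE (fun i => T^[M i] ⁻¹' A)
    (fun i => (hmp _).measurable hA)
    (fun i => ((hmp (M i)).measureReal_preimage hA.nullMeasurableSet).ge) hc
  rcases lt_trichotomy g h with h1 | rfl | h1
  · exact ⟨g, h, h1, hgh, hle.trans_eq (hlt g h h1)⟩
  · exact absurd hgh (hirrefl g)
  · exact ⟨h, g, h1, hsymm _ _ hgh, by rwa [← hlt h g h1, Set.inter_comm]⟩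

end Recurrence

section Perturbation

open ComplexConjugate AddCircle

lemma norm_fourier_apply (k : ℤ) (t : UnitAddCircle) : ‖fourier k t‖ = 1 := by
  rw [fourier_apply]; exact Circle.norm_coe _

lemma continuous_tsum_fourier {u : ℕ → ℂ} (hu : Summable fun n => ‖u n‖) :
    Continuous fun t : UnitAddCircle => ∑' n : ℕ, u n * fourier n t :=
  continuous_tsum (fun n => by fun_prop) hu fun n t => by
    rw [norm_mul, norm_fourier_apply, mul_one]

lemma integrable_of_continuous {f : UnitAddCircle → ℂ} (hf : Continuous f)
    (μ : Measure UnitAddCircle) [IsFiniteMeasure μ] : Integrable f μ :=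
  hf.integrable_of_hasCompactSupport (HasCompactSupport.of_compactSpace _)

lemma integral_fourier_mul_tsum {u : ℕ → ℂ} (hu : Summable fun n => ‖u n‖) (k : ℤ) :
    ∫ t : UnitAddCircle, fourier (-k) t * ∑' n : ℕ, u n * fourier n t ∂haarAddCircle =
      ∑' n : ℕ, if (n : ℤ) = k then u n else 0 := by
  have h (n : ℕ) (t : UnitAddCircle) : ‖fourier (-k) t * (u n * fourier n t)‖ = ‖u n‖ := by
    rw [norm_mul, norm_mul, norm_fourier_apply, norm_fourier_apply, one_mul, mul_one]
  have := hasSum_integral_of_summable_integral_norm (μ := haarAddCircle)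
    (F := fun (n : ℕ) (t : UnitAddCircle) => fourier (-k) t * (u n * fourier n t))
    (fun n => integrable_of_continuous (by fun_prop) _)
    (by simpa only [h, integral_const, probReal_univ, one_smul] using hu)
  simp only [tsum_mul_left] at this
  rw [← this.tsum_eq]
  refine tsum_congr fun n => ?_
  have h2 := congrFun (fourierCoeff_fourier (T := 1) n) k
  simp only [fourierCoeff, smul_eq_mul] at h2
  simp only [mul_left_comm _ (u n), integral_const_mul]
  rw [h2]
  simp [Pi.single_apply, eq_comm]

lemma integral_fourier_mul_re_tsum {u : ℕ → ℂ} (hu : Summable fun n => ‖u n‖) (hu0 : u 0 = 0)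
    (k : ℕ) :
    ∫ t : UnitAddCircle, fourier (-(k : ℤ)) t * ((∑' n : ℕ, u n * fourier n t).re : ℂ)
      ∂haarAddCircle = u k / 2 := by
  have hc := continuous_tsum_fourier hu
  have h1 := integral_fourier_mul_tsum hu k
  have h2 := congrArg conj (integral_fourier_mul_tsum hu (-k))
  rw [← integral_conj] at h2
  simp only [map_mul, neg_neg, ← fourier_neg] at h2
  have h3 (n : ℕ) : (if (n : ℤ) = -k then u n else 0) = 0 := by
    split_ifs with h
    · obtain rfl : n = 0 := by omega
      exact hu0
    · rfl
  simp only [h3, tsum_zero, map_zero] at h2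
  simp only [Nat.cast_inj, tsum_ite_eq] at h1
  simp only [Complex.re_eq_add_conj, mul_div_assoc', mul_add]
  rw [integral_div, integral_add, h1, h2, add_zero]
  · exact integrable_of_continuous (by fun_prop) _
  · exact integrable_of_continuous (by fun_prop) _

/-- Small Fourier coefficients can be cancelled at the cost of a small loss of mass. -/
lemma exists_measureFourier_eq_zero (μ : Measure UnitAddCircle) [IsProbabilityMeasure μ]
    {s : ℝ} (hs0 : 0 ≤ s) (hs1 : s ≤ 1) {u : ℕ → ℂ} (hu : Summable fun n => ‖u n‖)
    (hu0 : u 0 = 0) (hus : 2 * ∑' n, ‖u n‖ ≤ s) :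
    ∃ ν : Measure UnitAddCircle, IsProbabilityMeasure ν ∧
      (∀ k : ℕ, k ≠ 0 → measureFourier μ k = u k → measureFourier ν k = 0) ∧
      (1 - s) * μ.real {0} ≤ ν.real {0} := by
  set G : UnitAddCircle → ℂ := fun t => ∑' n : ℕ, u n * fourier n t with hG
  have hGc : Continuous G := continuous_tsum_fourier hu
  have hGle (t) : ‖G t‖ ≤ ∑' n, ‖u n‖ := by
    have h (n : ℕ) : ‖u n * fourier n t‖ = ‖u n‖ := by
      rw [norm_mul, norm_fourier_apply, mul_one]
    simpa only [h] using norm_tsum_le_tsum_norm (f := fun n : ℕ => u n * fourier n t)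
      (by simpa only [h] using hu)
  set F : UnitAddCircle → ℝ := fun t => s - 2 * (1 - s) * (G t).re with hF
  have hFc : Continuous F := by fun_prop
  have hF0 (t) : 0 ≤ F t := by
    have h1 := (Complex.re_le_norm (G t)).trans (hGle t)
    have h2 : 0 ≤ ∑' n, ‖u n‖ := tsum_nonneg fun n => norm_nonneg _
    have h3 : (1 - s) * (G t).re ≤ 1 * ∑' n, ‖u n‖ := by
      refine (mul_le_mul_of_nonneg_left h1 (by linarith)).trans ?_
      gcongr
      linarith
    simp only [hF]
    linarith
  have hFint (k : ℕ) : ∫ t, fourier (-(k : ℤ)) t * (F t : ℂ) ∂haarAddCircle =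
      (if k = 0 then (s : ℂ) else 0) - (1 - s) * u k := by
    have h1 := integral_fourier_mul_re_tsum hu hu0 k
    have h2 := congrFun (fourierCoeff_fourier (T := 1) 0) k
    simp only [fourierCoeff, fourier_zero, smul_eq_mul, mul_one, Pi.single_apply,
      Nat.cast_eq_zero] at h2
    have h3 (t : UnitAddCircle) : fourier (-(k : ℤ)) t * (F t : ℂ) =
        s * fourier (-(k : ℤ)) t - 2 * (1 - s) * (fourier (-(k : ℤ)) t * ((G t).re : ℂ)) := by
      simp [hF]; ring
    simp only [h3]
    rw [integral_sub (integrable_of_continuous (by fun_prop) _)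
      (integrable_of_continuous (by fun_prop) _), integral_const_mul, integral_const_mul, h2, h1]
    split_ifs <;> ring
  set ν₀ : Measure UnitAddCircle := haarAddCircle.withDensity fun t => ENNReal.ofReal (F t)
  have hν₀ (k : ℕ) : measureFourier ν₀ k =
      (if k = 0 then (s : ℂ) else 0) - (1 - s) * u k := by
    rw [← hFint, measureFourier, integral_withDensity_eq_integral_toReal_smul
      (by fun_prop) (by simp)]
    refine integral_congr_ae (.of_forall fun t => ?_)
    simp [hF0, mul_comm]
  have hν₀fin : IsFiniteMeasure ν₀ :=
    isFiniteMeasure_withDensity_ofReal (hFc.integrable_of_hasCompactSupport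
      (HasCompactSupport.of_compactSpace _)).2
  have hmass : ν₀.real Set.univ = s := by
    have := hν₀ 0
    simpa [measureFourier, hu0, ← Complex.ofReal_inj] using this
  refine ⟨ENNReal.ofReal (1 - s) • μ + ν₀, ⟨?_⟩, fun k hk hμk => ?_, ?_⟩
  · rw [Measure.add_apply, Measure.smul_apply, measure_univ, ← ofReal_measureReal, hmass,
      smul_eq_mul, mul_one, ← ENNReal.ofReal_add (by linarith) hs0]
    simp
  · have hμf : IsFiniteMeasure (ENNReal.ofReal (1 - s) • μ) := μ.smul_finite (by simp)
    rw [measureFourier, integral_add_measure (integrable_of_continuous (by fun_prop) _)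
      (integrable_of_continuous (by fun_prop) _), integral_smul_measure]
    simp only [measureFourier] at hμk hν₀
    rw [hμk, hν₀, if_neg hk, ENNReal.toReal_ofReal (by linarith)]
    simp
  · have hμf : IsFiniteMeasure (ENNReal.ofReal (1 - s) • μ) := μ.smul_finite (by simp)
    rw [measureReal_add_apply, measureReal_ennreal_smul_apply, ENNReal.toReal_ofReal (by linarith)]
    linarith [measureReal_nonneg (μ := ν₀) (s := {0})]

end Perturbation

section Digits

open Real

lemma exists_two_pow_mul_ofDigits (d : ℕ → Fin 2) {j g : ℕ}
    (hd : ∀ i, j < i → i ≤ j + g → d i = 0) :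
    ∃ (m : ℕ) (x : ℝ), 0 ≤ x ∧ x ≤ (2 ^ g)⁻¹ ∧
      2 ^ j * ofDigits d = m + (d j : ℕ) / 2 + x / 2 := by
  refine ⟨∑ i ∈ Finset.range j, (d i : ℕ) * 2 ^ (j - (i + 1)),
    ofDigits fun i => d (i + (j + 1)), ofDigits_nonneg _, ?_, ?_⟩
  · have h := ofDigits_eq_sum_add_ofDigits (fun i => d (i + (j + 1))) g
    rw [Finset.sum_eq_zero, zero_add] at h
    · rw [h]
      exact mul_le_of_le_one_right (by positivity) (ofDigits_le_one _)
    · intro i hi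
      rw [Finset.mem_range] at hi
      rw [ofDigitsTerm, hd _ (by omega) (by omega)]
      simp
  · rw [ofDigits_eq_sum_add_ofDigits d (j + 1), Finset.sum_range_succ, mul_add, mul_add,
      Finset.mul_sum]
    push_cast
    congr 1
    · congr 1
      · refine Finset.sum_congr rfl fun i hi => ?_
        rw [Finset.mem_range] at hi
        rw [ofDigitsTerm, pow_sub₀ _ two_ne_zero (by omega)]
        push_cast
        ring
      · rw [ofDigitsTerm, pow_succ]; push_cast; field_simp
    · rw [pow_succ]; field_simp

lemma norm_fourier_ofDigits_sub_le (d : ℕ → Fin 2) {j g : ℕ}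
    (hd : ∀ i, j < i → i ≤ j + g → d i = 0) :
    ‖fourier (2 ^ j) ((ofDigits d : ℝ) : UnitAddCircle) - (-1) ^ (d j : ℕ)‖ ≤ π * (2 ^ g)⁻¹ := by
  obtain ⟨m, x, hx0, hx, h⟩ := exists_two_pow_mul_ofDigits d hd
  have h1 : fourier (2 ^ j) ((ofDigits d : ℝ) : UnitAddCircle) =
      (-1) ^ (d j : ℕ) * Complex.exp (Complex.I * (π * x : ℝ)) := by
    have h' : (2 : ℂ) ^ j * (ofDigits d : ℝ) = m + (d j : ℕ) / 2 + x / 2 := by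
      simpa using congrArg (fun y : ℝ => (y : ℂ)) h
    rw [fourier_coe_apply]
    have : 2 * (π : ℂ) * Complex.I * ((2 ^ j : ℤ) : ℂ) * (ofDigits d : ℝ) / (1 : ℝ) =
        m * (2 * π * Complex.I) + ((d j : ℕ) * (π * Complex.I) + Complex.I * (π * x : ℝ)) := by
      push_cast
      linear_combination (2 * (π : ℂ) * Complex.I) * h'
    rw [this, Complex.exp_add, Complex.exp_add, Complex.exp_nat_mul_two_pi_mul_I,
      Complex.exp_nat_mul, Complex.exp_pi_mul_I, one_mul]
  rw [h1, ← mul_sub_one, norm_mul, norm_pow, norm_neg, norm_one, one_pow, one_mul]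
  refine norm_exp_I_mul_ofReal_sub_one_le.trans ?_
  rw [norm_of_nonneg (by positivity)]
  gcongr

lemma norm_fourier_ofDigits_sub_mul_le (d : ℕ → Fin 2) {j k g : ℕ}
    (hj : ∀ i, j < i → i ≤ j + g → d i = 0) (hk : ∀ i, k < i → i ≤ k + g → d i = 0) :
    ‖fourier (2 ^ j - 2 ^ k) ((ofDigits d : ℝ) : UnitAddCircle) -
      (-1) ^ (d j : ℕ) * (-1) ^ (d k : ℕ)‖ ≤ 2 * π * (2 ^ g)⁻¹ := by
  have h1 := norm_fourier_ofDigits_sub_le d hj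
  have h2 := norm_fourier_ofDigits_sub_le d hk
  set a := fourier (2 ^ j) ((ofDigits d : ℝ) : UnitAddCircle)
  set b := fourier (2 ^ k) ((ofDigits d : ℝ) : UnitAddCircle)
  have hb : ‖b‖ = 1 := norm_fourier_apply _ _
  rw [← Complex.norm_conj] at h2
  simp only [map_sub, map_pow, map_neg, map_one] at h2
  rw [sub_eq_add_neg (2 ^ j : ℤ), fourier_add, fourier_neg]
  calc ‖a * starRingEnd ℂ b - (-1) ^ (d j : ℕ) * (-1) ^ (d k : ℕ)‖
      = ‖(a - (-1) ^ (d j : ℕ)) * starRingEnd ℂ b +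
          (-1) ^ (d j : ℕ) * (starRingEnd ℂ b - (-1) ^ (d k : ℕ))‖ := by congr 1; ring
    _ ≤ ‖a - (-1) ^ (d j : ℕ)‖ + ‖starRingEnd ℂ b - (-1) ^ (d k : ℕ)‖ := by
      refine (norm_add_le _ _).trans_eq ?_
      simp [hb]
    _ ≤ 2 * π * (2 ^ g)⁻¹ := by linarith

lemma exists_measure_of_mem_cutPolytope {V : Type*} [Finite V] {k : V → V → ℝ}
    (hk : k ∈ cutPolytope V) : ∃ P : Measure (V → Fin 2), IsProbabilityMeasure P ∧
      ∀ g h, ∫ s, ((-1) ^ (s g : ℕ) * (-1) ^ (s h : ℕ) : ℝ) ∂P = k g h := by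
  have : cutPolytope V ⊆ {k | ∃ P : Measure (V → Fin 2), IsProbabilityMeasure P ∧
      ∀ g h, ∫ s, ((-1) ^ (s g : ℕ) * (-1) ^ (s h : ℕ) : ℝ) ∂P = k g h} := by
    refine convexHull_min ?_ ?_
    · rintro _ ⟨s, rfl⟩
      exact ⟨Measure.dirac s, inferInstance, fun g h => by simp⟩
    · rintro k ⟨P, hP, hk⟩ l ⟨Q, hQ, hl⟩ a b ha hb hab
      have hPf : IsFiniteMeasure (ENNReal.ofReal a • P) := P.smul_finite (by simp)
      have hQf : IsFiniteMeasure (ENNReal.ofReal b • Q) := Q.smul_finite (by simp)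
      refine ⟨ENNReal.ofReal a • P + ENNReal.ofReal b • Q, ⟨?_⟩, fun g h => ?_⟩
      · simp [← ENNReal.ofReal_add ha hb, hab]
      · rw [integral_add_measure .of_finite .of_finite, integral_smul_measure,
          integral_smul_measure, hk, hl, ENNReal.toReal_ofReal ha, ENNReal.toReal_ofReal hb]
        rfl
  exact this hk

/-- A measure on the circle whose Fourier coefficients at the differences of sparse powers of two
approximate prescribed points of cut polytopes. -/
lemma exists_measure_fourier_near {N : ℕ → ℕ} {K : ∀ k, Fin (N k) → Fin (N k) → ℝ}
    (hK : ∀ k, K k ∈ cutPolytope (Fin (N k))) {pos : (Σ k, Fin (N k)) → ℕ} {G : ℕ → ℕ}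
    (hinj : Function.Injective pos)
    (hgap : ∀ p q, pos p < pos q → pos p + G p.1 < pos q) :
    ∃ ρ : Measure UnitAddCircle, IsProbabilityMeasure ρ ∧ ∀ k g h,
      ‖measureFourier ρ (2 ^ pos ⟨k, h⟩ - 2 ^ pos ⟨k, g⟩) - K k g h‖ ≤
        2 * π * (2 ^ G k)⁻¹ := by
  choose P hP hPK using fun k => exists_measure_of_mem_cutPolytope (hK k)
  set Ω := ∀ k, Fin (N k) → Fin 2
  set Q : Measure Ω := Measure.infinitePi P
  set d : Ω → ℕ → Fin 2 := fun ω => Function.extend pos (fun p => ω p.1 p.2) 0 with hd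
  set t : Ω → UnitAddCircle := fun ω => ((ofDigits (d ω) : ℝ) : UnitAddCircle) with ht
  have htm : Measurable t := by
    have h1 : Measurable d := by
      rw [measurable_pi_iff]
      intro i
      by_cases hi : ∃ p, pos p = i
      · obtain ⟨p, rfl⟩ := hi
        simp only [hd, hinj.extend_apply]
        fun_prop
      · simp only [hd, Function.extend_apply' _ _ _ hi]
        fun_prop
    exact (AddCircle.measurable_mk'.comp continuous_ofDigits.measurable).comp h1
  have hdpos (ω p) : d ω (pos p) = ω p.1 p.2 := hinj.extend_apply _ _ _
  have hdgap (ω p) (i) (h1 : pos p < i) (h2 : i ≤ pos p + G p.1) : d ω i = 0 := by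
    refine Function.extend_apply' _ _ _ ?_
    rintro ⟨q, rfl⟩
    exact absurd (hgap p q h1) (by omega)
  have : IsProbabilityMeasure (Q.map t) := Measure.isProbabilityMeasure_map htm.aemeasurable
  refine ⟨Q.map t, this, fun k g h => ?_⟩
  have hm (i : Fin (N k)) : Measurable fun ω : Ω => ω k i := by fun_prop
  have hKint : ∫ ω : Ω, ((-1) ^ (ω k g : ℕ) * (-1) ^ (ω k h : ℕ) : ℂ) ∂Q = K k g h := by
    have h1 := (measurePreserving_eval_infinitePi P k).map_eq
    rw [← hPK, ← integral_complex_ofReal, ← h1,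
      integral_map (measurable_pi_apply k).aemeasurable (by
        exact (measurable_of_finite _).aestronglyMeasurable)]
    simp [Q, Ω]
  have hi1 : Integrable (fun ω : Ω => ((-1) ^ (ω k g : ℕ) * (-1) ^ (ω k h : ℕ) : ℂ)) Q := by
    refine Integrable.of_bound (C := 1) ?_ (.of_forall fun ω => by simp)
    exact ((measurable_of_finite fun x : Fin 2 × Fin 2 =>
      ((-1) ^ (x.1 : ℕ) * (-1) ^ (x.2 : ℕ) : ℂ)).comp ((hm g).prodMk (hm h))).aestronglyMeasurable
  have hi2 (n : ℤ) : Integrable (fun ω => fourier n (t ω)) Q :=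
    Integrable.of_bound (C := 1) ((fourier n).continuous.measurable.comp htm).aestronglyMeasurable
      (.of_forall fun ω => (norm_fourier_apply _ _).le)
  rw [measureFourier, integral_map htm.aemeasurable
    (fourier _).continuous.aestronglyMeasurable, ← hKint, ← integral_sub (hi2 _) hi1]
  refine (norm_integral_le_of_norm_le_const (C := 2 * π * (2 ^ G k)⁻¹)
    (.of_forall fun ω => ?_)).trans_eq (by simp)
  have := norm_fourier_ofDigits_sub_mul_le (d ω) (hdgap ω ⟨k, g⟩) (hdgap ω ⟨k, h⟩)
  rw [hdpos, hdpos] at this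
  rwa [neg_sub]

end Digits

section Blocks

lemma cutPolytope_symm {V : Type*} [Finite V] {k : V → V → ℝ} (hk : k ∈ cutPolytope V)
    (g h : V) : k g h = k h g := by
  obtain ⟨P, -, hP⟩ := exists_measure_of_mem_cutPolytope hk
  simp only [← hP, mul_comm]

lemma cutPolytope_self {V : Type*} [Finite V] {k : V → V → ℝ} (hk : k ∈ cutPolytope V)
    (g : V) : k g g = 1 := by
  obtain ⟨P, _, hP⟩ := exists_measure_of_mem_cutPolytope hk
  rw [← hP]
  simp [← mul_pow]

/-- Consecutive blocks of `N k` positions, those of the `k`-th block followed by `G k` gaps. -/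
def blockPos {N : ℕ → ℕ} (G : ℕ → ℕ) (p : Σ k, Fin (N k)) : ℕ :=
  ∑ i ∈ Finset.range p.1, N i * (G i + 1) + p.2 * (G p.1 + 1)

lemma blockPos_add_lt_of_fst_lt {N : ℕ → ℕ} (G : ℕ → ℕ) {p q : Σ k, Fin (N k)} (h : p.1 < q.1) :
    blockPos G p + G p.1 < blockPos G q := by
  have h1 : ∑ i ∈ Finset.range (p.1 + 1), N i * (G i + 1) ≤
      ∑ i ∈ Finset.range q.1, N i * (G i + 1) :=
    Finset.sum_le_sum_of_subset (Finset.range_mono h)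
  have h2 : (p.2.val + 1) * (G p.1 + 1) ≤ N p.1 * (G p.1 + 1) :=
    Nat.mul_le_mul_right _ p.2.isLt
  rw [Finset.sum_range_succ] at h1
  rw [blockPos, blockPos]
  linarith [Nat.zero_le (q.2.val * (G q.1 + 1))]

lemma blockPos_add_lt_of_snd_lt {N : ℕ → ℕ} (G : ℕ → ℕ) {k : ℕ} {g h : Fin (N k)} (hgh : g < h) :
    blockPos G ⟨k, g⟩ + G k < blockPos G ⟨k, h⟩ := by
  have h2 : (g.val + 1) * (G k + 1) ≤ h.val * (G k + 1) := Nat.mul_le_mul_right _ hgh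
  simp only [blockPos]
  linarith

lemma blockPos_trichotomy {N : ℕ → ℕ} (G : ℕ → ℕ) (p q : Σ k, Fin (N k)) :
    p = q ∨ blockPos G p + G p.1 < blockPos G q ∨ blockPos G q + G q.1 < blockPos G p := by
  obtain ⟨k, g⟩ := p
  obtain ⟨l, h⟩ := q
  rcases lt_trichotomy k l with hkl | rfl | hkl
  · exact .inr (.inl (blockPos_add_lt_of_fst_lt G hkl))
  · rcases lt_trichotomy g h with hgh | rfl | hgh
    · exact .inr (.inl (blockPos_add_lt_of_snd_lt G hgh))
    · exact .inl rfl
    · exact .inr (.inr (blockPos_add_lt_of_snd_lt G hgh))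
  · exact .inr (.inr (blockPos_add_lt_of_fst_lt G hkl))

lemma blockPos_injective {N : ℕ → ℕ} (G : ℕ → ℕ) :
    Function.Injective (blockPos G : (Σ k, Fin (N k)) → ℕ) := fun p q h => by
  rcases blockPos_trichotomy G p q with h' | h' | h'
  · exact h'
  · omega
  · omega

lemma blockPos_add_lt {N : ℕ → ℕ} (G : ℕ → ℕ) (p q : Σ k, Fin (N k))
    (h : blockPos G p < blockPos G q) : blockPos G p + G p.1 < blockPos G q := by
  rcases blockPos_trichotomy G p q with rfl | h' | h' <;> omega

/-- Differences of powers of two joined by edges of weight `-1/2` within one block. -/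
def blockDifferences {N : ℕ → ℕ} (K : ∀ k, Fin (N k) → Fin (N k) → ℝ) (G : ℕ → ℕ) : Set ℕ :=
  (fun p : Σ k, Fin (N k) × Fin (N k) =>
    2 ^ blockPos G ⟨p.1, p.2.2⟩ - 2 ^ blockPos G ⟨p.1, p.2.1⟩) ''
  {p | p.2.1 < p.2.2 ∧ K p.1 p.2.1 p.2.2 = -1 / 2}

lemma lt_two_pow_blockPos_sub {N : ℕ → ℕ} (G : ℕ → ℕ) {k : ℕ} {g h : Fin (N k)} (hgh : g < h) :
    G k < 2 ^ blockPos G ⟨k, h⟩ - 2 ^ blockPos G ⟨k, g⟩ := by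
  have h1 := blockPos_add_lt_of_snd_lt G hgh
  have h2 : 2 ^ (blockPos G ⟨k, g⟩ + (G k + 1)) ≤ 2 ^ blockPos G ⟨k, h⟩ :=
    Nat.pow_le_pow_right two_pos h1
  have h3 : 1 ≤ 2 ^ blockPos G ⟨k, g⟩ := Nat.one_le_two_pow
  have h4 : G k + 1 < 2 ^ (G k + 1) := Nat.lt_two_pow_self
  rw [pow_add] at h2
  have h5 : 2 ^ blockPos G ⟨k, g⟩ + G k < 2 ^ blockPos G ⟨k, g⟩ * 2 ^ (G k + 1) := by nlinarith
  omega

lemma frequently_blockDifferences {N : ℕ → ℕ} {K : ∀ j, Fin (N j) → Fin (N j) → ℝ}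
    (hK : ∀ j, K j ∈ cutPolytope (Fin (N j)))
    (hdense : ∀ j, ∀ A : Finset (Fin (N j)), 1 / ((j : ℝ) + 1) * N j ≤ A.card →
      ∃ g ∈ A, ∃ h ∈ A, K j g h = -1 / 2)
    {G : ℕ → ℕ} (hG : ∀ k, k ≤ G k)
    {X : Type*} [MeasurableSpace X] {μ : Measure X} [IsProbabilityMeasure μ] {T : X → X}
    (hT : MeasurePreserving T μ μ) {A : Set X} (hA : MeasurableSet A) (hμA : 0 < μ A) :
    ∃ c : ℝ, 0 < c ∧ ∃ᶠ m in atTop,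
      m ∈ blockDifferences (fun k => K k.unpair.1) G ∧ c ≤ μ.real (A ∩ T^[m] ⁻¹' A) := by
  have ha : 0 < μ.real A := ENNReal.toReal_pos hμA.ne' (measure_ne_top μ A)
  obtain ⟨j, hj⟩ := exists_nat_one_div_lt ha
  refine ⟨(μ.real A - 1 / (j + 1)) / (N j ^ 2 + 1), div_pos (by linarith) (by positivity),
    frequently_atTop.2 fun a => ?_⟩
  have hc : 1 / ((j : ℝ) + 1) + N j ^ 2 * ((μ.real A - 1 / (j + 1)) / (N j ^ 2 + 1)) <
      μ.real A := by
    have : (N j : ℝ) ^ 2 * ((μ.real A - 1 / (j + 1)) / (N j ^ 2 + 1)) <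
        μ.real A - 1 / (j + 1) := by
      rw [mul_div_assoc', div_lt_iff₀ (by positivity)]
      nlinarith
    linarith
  set c := (μ.real A - 1 / (j + 1)) / (N j ^ 2 + 1) with hcdef
  have hc0 : 0 ≤ c := div_nonneg (by linarith) (by positivity)
  obtain ⟨k, hka, rfl⟩ : ∃ k, a ≤ k ∧ k.unpair.1 = j :=
    ⟨Nat.pair j a, Nat.right_le_pair j a, by simp⟩
  obtain ⟨g, h, hgh, hE, hle⟩ := exists_edge_le_measureReal_inter_preimage hT hA
    (E := fun g h => K k.unpair.1 g h = -1 / 2) (by positivity) hc0 (hdense _)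
    (fun g h hgh => (cutPolytope_symm (hK _) h g).trans hgh)
    (fun g => by rw [cutPolytope_self (hK _)]; norm_num) hc
    (M := fun i => 2 ^ blockPos G (⟨k, i⟩ : Σ k : ℕ, Fin (N k.unpair.1))) fun g h hgh => by
      refine Nat.pow_le_pow_right two_pos ?_
      rcases hgh.eq_or_lt with rfl | hgh
      · rfl
      · have := blockPos_add_lt_of_snd_lt (N := fun k => N k.unpair.1) G hgh
        omega
  exact ⟨_, (hka.trans (hG k)).trans
    (lt_two_pow_blockPos_sub (N := fun k => N k.unpair.1) G hgh).le,
    ⟨⟨k, g, h⟩, ⟨hgh, hE⟩, rfl⟩, hle⟩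

lemma tsum_norm_indicator_image_le {I : Type*} {r : I → ℕ} {S : Set I} {w : I → ℝ}
    (hw : Summable w) (hw0 : ∀ i, 0 ≤ w i) {v : ℕ → ℂ} (hv : ∀ i ∈ S, ‖v (r i)‖ ≤ w i) :
    (Summable fun n => ‖(r '' S).indicator v n‖) ∧
      ∑' n, ‖(r '' S).indicator v n‖ ≤ ∑' i, w i := by
  choose σ hσS hσ using fun n : r '' S => n.2
  have hinj : Function.Injective σ := fun m n h => Subtype.ext (by rw [← hσ, h, hσ])
  have hle (n : r '' S) : ‖v n‖ ≤ w (σ n) := by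
    have := hv _ (hσS n)
    rwa [hσ] at this
  have hws : Summable (w ∘ σ) := hw.comp_injective hinj
  have hs : Summable fun n : r '' S => ‖v n‖ :=
    hws.of_nonneg_of_le (fun _ => norm_nonneg _) hle
  have h2 : (fun n => ‖(r '' S).indicator v n‖) = (r '' S).indicator fun n => ‖v n‖ := by
    ext n
    exact norm_indicator_eq_indicator_norm _ _
  rw [h2]
  refine ⟨summable_subtype_iff_indicator.1 hs, ?_⟩
  rw [← tsum_subtype]
  exact (hs.tsum_le_tsum hle hws).trans (tsum_comp_le_tsum_of_inj hw hw0 hinj)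

lemma summable_block_weights (N : ℕ → ℕ) {C : ℕ} {b : ℝ} (hb : 0 ≤ b) :
    (Summable fun p : Σ k, Fin (N k) × Fin (N k) => b * (2 ^ (C + p.1 + 2 * N p.1))⁻¹) ∧
      ∑' p : Σ k, Fin (N k) × Fin (N k), b * (2 ^ (C + p.1 + 2 * N p.1))⁻¹ ≤
        2 * b * (1 / 2) ^ C := by
  have hle (k : ℕ) : ∑' _ : Fin (N k) × Fin (N k), b * (2 ^ (C + k + 2 * N k))⁻¹ ≤
      b * (1 / 2) ^ C * (1 / 2) ^ k := by
    have h1 : (N k : ℝ) ≤ 2 ^ N k := by exact_mod_cast Nat.lt_two_pow_self.le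
    have h2 : (N k : ℝ) * N k * (2 ^ (2 * N k))⁻¹ ≤ 1 := by
      rw [← div_eq_mul_inv, div_le_one (by positivity), two_mul, pow_add]
      gcongr
    rw [tsum_const, Nat.card_eq_fintype_card]
    simp only [Fintype.card_prod, Fintype.card_fin, nsmul_eq_mul, pow_add, mul_inv, one_div,
      inv_pow]
    push_cast
    calc (N k * N k * (b * ((2 ^ C)⁻¹ * (2 ^ k)⁻¹ * (2 ^ (2 * N k))⁻¹)) : ℝ)
        = b * (2 ^ C)⁻¹ * (2 ^ k)⁻¹ * (N k * N k * (2 ^ (2 * N k))⁻¹) := by ring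
      _ ≤ b * (2 ^ C)⁻¹ * (2 ^ k)⁻¹ * 1 := by gcongr
      _ = _ := mul_one _
  have hg : Summable fun k : ℕ => b * (1 / 2) ^ C * (1 / 2 : ℝ) ^ k :=
    summable_geometric_two.mul_left _
  have hs : Summable fun p : Σ k, Fin (N k) × Fin (N k) => b * (2 ^ (C + p.1 + 2 * N p.1))⁻¹ := by
    refine (summable_sigma_of_nonneg fun p => by positivity).2 ⟨fun k => .of_finite, ?_⟩
    exact hg.of_nonneg_of_le (fun k => tsum_nonneg fun _ => by positivity) hle
  refine ⟨hs, ?_⟩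
  rw [hs.tsum_sigma]
  refine (hs.sigma.tsum_le_tsum hle hg).trans_eq ?_
  rw [tsum_mul_left, tsum_geometric_two]
  ring

end Blocks

/-- For every `ε ∈ (0, 1/3)` there is a set `R ⊆ ℕ` which is a set of strong recurrence
(for every measure preserving system and every `A` with `μ(A) > 0`, we have
`limsup_{m → ∞, m ∈ R} μ(A ∩ T⁻ᵐA) > 0`) but not an `ε`-vdC set (some Borel probability
measure on the torus has Fourier transform vanishing on `R` yet an atom of mass `> ε`
at `0`). In particular, `R` is a set of strong recurrence that is not a van der Corput
set. -/
theorem strong_recurrence_not_vdC (ε : ℝ) (hε0 : 0 < ε) (hε1 : ε < 1 / 3) :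
    ∃ R : Set ℕ, R.Infinite ∧
      (∀ (X : Type) (_ : MeasurableSpace X) (μ : Measure X), IsProbabilityMeasure μ →
        ∀ T : X → X, MeasurePreserving T μ μ → ∀ A : Set X, MeasurableSet A → 0 < μ A →
          0 < Filter.limsup (fun m : ℕ => μ (A ∩ (T^[m]) ⁻¹' A))
              (Filter.atTop ⊓ Filter.principal R)) ∧
      (∃ μ : Measure UnitAddCircle, IsProbabilityMeasure μ ∧
        (∀ r ∈ R, measureFourier μ r = 0) ∧ ε < (μ {(0 : UnitAddCircle)}).toReal) := by
  choose N K hK hdense using fun j : ℕ =>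
    exists_mem_cutPolytope_dense_edge (δ := 1 / ((j : ℝ) + 1)) (by positivity)
  set s : ℝ := (1 - 3 * ε) / 2 with hs
  have hs0 : 0 < s := by linarith
  obtain ⟨C, hC⟩ := exists_pow_lt_of_lt_one (show 0 < s / 64 by positivity)
    (show (1 / 2 : ℝ) < 1 by norm_num)
  set N' : ℕ → ℕ := fun k => N k.unpair.1
  set K' : ∀ k, Fin (N' k) → Fin (N' k) → ℝ := fun k => K k.unpair.1
  set G : ℕ → ℕ := fun k => C + k + 2 * N' k with hG
  have hrec {X : Type} [MeasurableSpace X] {μ : Measure X} [IsProbabilityMeasure μ] {T : X → X}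
      (hT : MeasurePreserving T μ μ) {A : Set X} (hA : MeasurableSet A) (hμA : 0 < μ A) :=
    frequently_blockDifferences hK hdense (G := G) (by intro k; simp only [hG]; omega) hT hA hμA
  refine ⟨blockDifferences K' G, ?_, fun X _ μ _ T hT A hA hμA => ?_, ?_⟩
  · obtain ⟨c, -, h⟩ := hrec (MeasurePreserving.id (Measure.dirac ())) .univ (by simp)
    exact Nat.frequently_atTop_iff_infinite.1 (h.mono fun m hm => hm.1)
  · obtain ⟨c, hc, h⟩ := hrec hT hA hμA
    refine (ENNReal.ofReal_pos.2 hc).trans_le (le_limsup_of_frequently_le ?_)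
    rw [frequently_inf_principal]
    exact h.mono fun m hm => ⟨hm.1, ENNReal.ofReal_le_of_le_toReal hm.2⟩
  · obtain ⟨ρ, hρ, hρK⟩ := exists_measure_fourier_near (fun k => hK k.unpair.1)
      (blockPos_injective (N := N') G) (blockPos_add_lt G)
    have hρ' : IsFiniteMeasure (ENNReal.ofReal (2 / 3) • ρ) := ρ.smul_finite (by simp)
    have hdf : IsFiniteMeasure (ENNReal.ofReal (1 / 3) • Measure.dirac (0 : UnitAddCircle)) :=
      Measure.smul_finite _ (by simp)
    set μ : Measure UnitAddCircle :=
      ENNReal.ofReal (1 / 3) • Measure.dirac 0 + ENNReal.ofReal (2 / 3) • ρ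
    have hμ : IsProbabilityMeasure μ := ⟨by
      simp only [μ, Measure.add_apply, Measure.smul_apply, measure_univ, smul_eq_mul, mul_one]
      rw [← ENNReal.ofReal_add (by norm_num) (by norm_num)]
      norm_num⟩
    have hμ0 : 1 / 3 ≤ μ.real {0} := by
      simp only [μ]
      rw [measureReal_add_apply, measureReal_ennreal_smul_apply,
        ENNReal.toReal_ofReal (by norm_num), measureReal_def (μ := Measure.dirac 0),
        Measure.dirac_apply_of_mem (Set.mem_singleton _)]
      have : 0 ≤ (ENNReal.ofReal (2 / 3)).toReal * ρ.real {0} := by positivity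
      simpa using this
    have hμhat (r : ℤ) : measureFourier μ r = 1 / 3 + 2 / 3 * measureFourier ρ r := by
      simp only [μ, measureFourier]
      rw [integral_add_measure (integrable_of_continuous (by fun_prop) _)
        (integrable_of_continuous (by fun_prop) _), integral_smul_measure, integral_smul_measure,
        integral_dirac, ENNReal.toReal_ofReal (by norm_num), ENNReal.toReal_ofReal (by norm_num)]
      simp
    have hR0 (r : ℕ) (hr : r ∈ blockDifferences K' G) : r ≠ 0 := by
      obtain ⟨⟨k, g, h⟩, ⟨hgh, -⟩, rfl⟩ := hr
      exact (Nat.zero_le _).trans_lt (lt_two_pow_blockPos_sub G hgh) |>.ne'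
    obtain ⟨hw, hwle⟩ := summable_block_weights N' (C := C) (b := 4 * Real.pi / 3) (by positivity)
    obtain ⟨hu, hule⟩ := tsum_norm_indicator_image_le
      (r := fun p : Σ k, Fin (N' k) × Fin (N' k) =>
        2 ^ blockPos G ⟨p.1, p.2.2⟩ - 2 ^ blockPos G ⟨p.1, p.2.1⟩)
      (S := {p | p.2.1 < p.2.2 ∧ K' p.1 p.2.1 p.2.2 = -1 / 2}) hw (fun p => by positivity)
      (v := fun n => measureFourier μ n) (by
        rintro ⟨k, g, h⟩ ⟨hgh, hE⟩
        have hle : blockPos G ⟨k, g⟩ ≤ blockPos G ⟨k, h⟩ :=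
          (Nat.le_add_right _ _).trans (blockPos_add_lt_of_snd_lt G hgh).le
        have hnear := hρK k g h
        have hE' : K k.unpair.1 g h = -1 / 2 := hE
        rw [hE'] at hnear
        simp only
        rw [Nat.cast_sub (Nat.pow_le_pow_right two_pos hle), Nat.cast_pow, Nat.cast_pow,
          Nat.cast_ofNat, hμhat]
        generalize measureFourier ρ _ = z at hnear ⊢
        calc ‖(1 / 3 + 2 / 3 * z : ℂ)‖ = ‖(2 / 3 : ℂ) * (z - ((-1 / 2 : ℝ) : ℂ))‖ := by
              congr 1
              push_cast
              ring
          _ = 2 / 3 * ‖z - ((-1 / 2 : ℝ) : ℂ)‖ := by simp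
          _ ≤ 2 / 3 * (2 * Real.pi * (2 ^ G k)⁻¹) := by gcongr
          _ = 4 * Real.pi / 3 * (2 ^ (C + k + 2 * N' k))⁻¹ := by ring)
    obtain ⟨ν, hν, hν0, hνμ⟩ := exists_measureFourier_eq_zero μ (s := s) hs0.le (by linarith) hu
      (Set.indicator_of_notMem (fun h => hR0 0 h rfl) _) (by
        refine (mul_le_mul_of_nonneg_left (hule.trans hwle) two_pos.le).trans ?_
        have : Real.pi * (1 / 2) ^ C ≤ 4 * (s / 64) :=
          mul_le_mul Real.pi_le_four hC.le (by positivity) (by norm_num)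
        linarith)
    refine ⟨ν, hν, fun r hr => hν0 r (hR0 r hr) ?_, ?_⟩
    · rw [Set.indicator_of_mem]
      exact hr
    · change ε < ν.real {0}
      nlinarith
end
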